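/- Let B ⊆ ℝ² be a closed ball of finite, positive radius and B̃ an open neighborhood of B. Let N ∈ ℕ, let a_k : B̃ → ℝ be real analytic for k = 1,…,N, and let φ : B̃ → ℝ be real analytic and nonconstant on B. Suppose that for every nonempty open set U ⊆ B̃ and every N-tuple (f₁,…,f_N) of real analytic functions on φ(U), if a₁(x)f₁(φ(x)) + ⋯ + a_N(x)f_N(φ(x)) = 0 for all x ∈ U, then each f_k vanishes identically on φ(U). Then there exist τ > 0 and C < ∞ such that for every ε > 0 and every N-tuple f = (f₁,…,f_N) of Lebesgue measurable functions f_k : ℝ → ℝ, the Lebesgue measure of {x ∈ B : |Σ_{k=1}^N a_k(x)f_k(φ(x))| < ε and ‖(f₁(φ(x)),…,f_N(φ(x)))‖ ≥ 1} is at most C·ε^τ. -/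

import Mathlib

open MeasureTheory Set
open scoped ENNReal

noncomputable section


/-- One-dimensional sublevel estimate. -/
theorem sublevel_one_dim (n : ℕ) : ∀ (I : Set ℝ), Convex ℝ I → ∀ (G : ℕ → ℝ → ℝ) (lam rho : ℝ),
    0 < lam → 0 < rho →
    (∀ j, ∀ x ∈ I, HasDerivWithinAt (G j) (G (j+1) x) I x) →
    (∀ x ∈ I, lam ≤ G n x) →
    volume {x ∈ I | |G 0 x| < lam * rho ^ n} ≤ ENNReal.ofReal ((2 ^ (n+1) - 2) * rho) := by
  induction n with
  | zero =>
    intro I hI G lam rho hl hr hG hn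
    have : {x ∈ I | |G 0 x| < lam * rho ^ 0} = ∅ := by
      ext x
      simp only [pow_zero, mul_one, mem_ofPred_eq, mem_empty_iff_false, iff_false, not_and, not_lt]
      intro hx
      exact (hn x hx).trans (le_abs_self _)
    rw [this]
    simp
  | succ n ih =>
    intro I hI G lam rho hl hr hG hn
    have hmono : ∀ᵉ (x ∈ I) (y ∈ I), x ≤ y → lam * (y - x) ≤ G n y - G n x := by
      apply hI.mul_sub_le_image_sub_of_le_deriv
      · exact fun x hx => (hG n x hx).continuousWithinAt
      · exact fun x hx => ((hG n x (interior_subset hx)).hasDerivAt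
          (mem_interior_iff_mem_nhds.1 hx)).differentiableAt.differentiableWithinAt
      · intro x hx
        rw [((hG n x (interior_subset hx)).hasDerivAt (mem_interior_iff_mem_nhds.1 hx)).deriv]
        exact hn x (interior_subset hx)
    set I1 := {x ∈ I | lam * rho ≤ G n x} with hI1
    set I2 := {x ∈ I | G n x ≤ - (lam * rho)} with hI2
    set I3 := {x ∈ I | |G n x| < lam * rho} with hI3
    have hle : ∀ᵉ (x ∈ I) (y ∈ I), x ≤ y → G n x ≤ G n y := by
      intro x hx y hy hxy
      have := hmono x hx y hy hxy
      have : 0 ≤ lam * (y - x) := mul_nonneg hl.le (by linarith)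
      linarith
    have c1 : Convex ℝ I1 := by
      apply Set.OrdConnected.convex
      refine ⟨fun x hx y hy z hz => ?_⟩
      have hzI := hI.ordConnected.out hx.1 hy.1 hz
      exact ⟨hzI, hx.2.trans (hle x hx.1 z hzI hz.1)⟩
    have c2 : Convex ℝ I2 := by
      apply Set.OrdConnected.convex
      refine ⟨fun x hx y hy z hz => ?_⟩
      have hzI := hI.ordConnected.out hx.1 hy.1 hz
      exact ⟨hzI, (hle z hzI y hy.1 hz.2).trans hy.2⟩
    have h1 := ih I1 c1 G (lam * rho) rho (by positivity) hr
      (fun j x hx => (hG j x hx.1).mono (fun _ h => h.1)) (fun x hx => hx.2)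
    have h2 := ih I2 c2 (fun j x => - G j x) (lam * rho) rho (by positivity) hr
      (fun j x hx => ((hG j x hx.1).mono (fun _ h => h.1)).neg) (fun x hx => by linarith [hx.2])
    have h3 : volume I3 ≤ ENNReal.ofReal (2 * rho) := by
      refine (Real.volume_le_diam _).trans ?_
      refine Metric.ediam_le fun x hx y hy => ?_
      rw [edist_dist, Real.dist_eq]
      apply ENNReal.ofReal_le_ofReal
      have key : ∀ x ∈ I3, ∀ y ∈ I3, x ≤ y → y - x ≤ 2 * rho := by
        intro x hx y hy hxy
        have h := hmono x hx.1 y hy.1 hxy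
        have a1 := abs_lt.1 hx.2
        have a2 := abs_lt.1 hy.2
        have : lam * (y - x) ≤ lam * (2 * rho) := by linarith
        exact le_of_mul_le_mul_left this hl
      rcases le_total x y with h | h
      · rw [abs_sub_comm, abs_of_nonneg (by linarith)]
        exact key x hx y hy h
      · rw [abs_of_nonneg (by linarith)]
        exact key y hy x hx h
    have hp : (2:ℝ) ≤ 2 ^ (n+1) := by
      have : (1:ℝ) ≤ 2 ^ n := one_le_pow₀ (by norm_num)
      rw [pow_succ]; linarith
    calc volume {x ∈ I | |G 0 x| < lam * rho ^ (n+1)}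
        ≤ volume (({x ∈ I1 | |G 0 x| < lam * rho * rho ^ n} ∪
            {x ∈ I2 | |(- G 0 x)| < lam * rho * rho ^ n}) ∪ I3) := by
          apply measure_mono
          rintro x ⟨hx, hx2⟩
          have e : lam * rho ^ (n+1) = lam * rho * rho ^ n := by ring
          rw [e] at hx2
          by_cases h : |G n x| < lam * rho
          · exact Or.inr ⟨hx, h⟩
          · left
            rcases le_abs.1 (not_lt.1 h) with h | h
            · exact Or.inl ⟨⟨hx, h⟩, hx2⟩
            · exact Or.inr ⟨⟨hx, by linarith⟩, by rwa [abs_neg]⟩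
      _ ≤ ENNReal.ofReal ((2 ^ (n+1) - 2) * rho) + ENNReal.ofReal ((2 ^ (n+1) - 2) * rho)
            + ENNReal.ofReal (2 * rho) := by
          refine (measure_union_le _ _).trans (add_le_add ((measure_union_le _ _).trans
            (add_le_add h1 h2)) h3)
      _ = _ := by
          have : 0 ≤ ((2:ℝ) ^ (n+1) - 2) * rho := mul_nonneg (by linarith) hr.le
          rw [← ENNReal.ofReal_add this this, ← ENNReal.ofReal_add (by positivity) (by positivity)]
          congr 1
          ring

theorem sublevel_one_dim_abs (n : ℕ) (I : Set ℝ) (hI : Convex ℝ I) (G : ℕ → ℝ → ℝ) (lam rho : ℝ)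
    (hl : 0 < lam) (hr : 0 < rho)
    (hG : ∀ j, ∀ x ∈ I, HasDerivWithinAt (G j) (G (j+1) x) I x)
    (hn : (∀ x ∈ I, lam ≤ G n x) ∨ (∀ x ∈ I, G n x ≤ -lam)) :
    volume {x ∈ I | |G 0 x| < lam * rho ^ n} ≤ ENNReal.ofReal ((2 ^ (n+1) - 2) * rho) := by
  rcases hn with hn | hn
  · exact sublevel_one_dim n I hI G lam rho hl hr hG hn
  · have := sublevel_one_dim n I hI (fun j x => - G j x) lam rho hl hr
      (fun j x hx => (hG j x hx).neg) (fun x hx => by linarith [hn x hx])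
    simpa using this

/-- An analytic function all of whose derivatives vanish at a point is zero. -/
theorem chain_zero (I : Set ℝ) (hI : IsOpen I) (hc : IsPreconnected I) (H : ℕ → ℝ → ℝ)
    (h0 : AnalyticOnNhd ℝ (H 0) I)
    (hH : ∀ j, ∀ x ∈ I, HasDerivAt (H j) (H (j+1) x) x) (x0 : ℝ) (hx0 : x0 ∈ I)
    (hz : ∀ j, H j x0 = 0) : ∀ x ∈ I, H 0 x = 0 := by
  have hit : ∀ j, ∀ x ∈ I, iteratedDeriv j (H 0) x = H j x := by
    intro j
    induction j with
    | zero => intro x hx; simp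
    | succ j ih =>
      intro x hx
      rw [iteratedDeriv_succ]
      have : iteratedDeriv j (H 0) =ᶠ[nhds x] H j := by
        filter_upwards [hI.mem_nhds hx] with y hy using ih y hy
      rw [this.deriv_eq, (hH j x hx).deriv]
  have han := h0 x0 hx0
  have htop : analyticOrderAt (H 0) x0 = ⊤ := by
    rw [ENat.eq_top_iff_forall_ge]
    intro n
    rw [natCast_le_analyticOrderAt_iff_iteratedDeriv_eq_zero han]
    intro i _
    rw [hit i x0 hx0, hz]
  rw [analyticOrderAt_eq_top] at htop
  exact h0.eqOn_zero_of_preconnected_of_eventuallyEq_zero hc hx0 htop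

/-- Either some maximal determinant is nonzero, or there is a nontrivial relation. -/
theorem det_or_relation {R : Type*} [CommRing R] [Nontrivial R] {ι : Type*} (N : ℕ) :
    ∀ (A : ι → Fin N → R),
    (∃ j : Fin N → ι, (Matrix.of fun i k => A (j i) k).det ≠ 0) ∨
    (∃ v : Fin N → R, v ≠ 0 ∧ ∀ j, ∑ k, A j k * v k = 0) := by
  induction N with
  | zero => intro A; left; exact ⟨Fin.elim0, by simp⟩
  | succ N ih =>
    intro A
    rcases ih (fun j k => A j k.succ) with ⟨j, hj⟩ | ⟨v, hv, hv2⟩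
    · by_cases h : ∃ j0, (Matrix.of fun i k => A ((Fin.cons j0 j : Fin (N+1) → ι) i) k).det ≠ 0
      · obtain ⟨j0, h⟩ := h
        exact Or.inl ⟨_, h⟩
      · push Not at h
        right
        refine ⟨fun k => (-1) ^ (k : ℕ) *
          (Matrix.of fun i l => A (j i) (k.succAbove l)).det, ?_, ?_⟩
        · intro h0
          apply hj
          have := congrFun h0 0
          simpa using this
        · intro j0
          have := h j0
          rw [Matrix.det_succ_row_zero] at this
          rw [← this]
          refine Finset.sum_congr rfl fun k _ => ?_
          simp only [Matrix.of_apply, Fin.cons_zero]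
          have e : (Matrix.of fun i k => A ((Fin.cons j0 j : Fin (N+1) → ι) i) k).submatrix
            Fin.succ k.succAbove = (Matrix.of fun i l => A (j i) (k.succAbove l)) := by
            ext i l; simp
          rw [e]; ring
    · right
      refine ⟨Fin.cons 0 v, ?_, ?_⟩
      · intro h0
        apply hv
        funext k
        simpa using congrFun h0 k.succ
      · intro j
        rw [Fin.sum_univ_succ]
        simpa using hv2 j

/-- Comparison of Haar measures through a linear equivalence. -/
theorem haar_compare {F : Type*} [NormedAddCommGroup F] [NormedSpace ℝ F]
    [FiniteDimensional ℝ F] [MeasurableSpace F] [BorelSpace F] (μ : Measure F) [μ.IsAddHaarMeasure]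
    (L : (ℝ × ℝ) ≃L[ℝ] F) :
    ∃ C : ℝ, 0 ≤ C ∧ ∀ S : Set F, μ S ≤ ENNReal.ofReal C * volume (L ⁻¹' S) := by
  have : (Measure.map L (volume : Measure (ℝ × ℝ))).IsAddHaarMeasure :=
    L.isAddHaarMeasure_map _
  have h := Measure.isAddLeftInvariant_eq_smul μ (Measure.map L (volume : Measure (ℝ × ℝ)))
  refine ⟨(Measure.addHaarScalarFactor μ (Measure.map L (volume : Measure (ℝ × ℝ))) : ℝ),
    NNReal.coe_nonneg _, fun S => ?_⟩
  · conv_lhs => rw [h]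
    rw [Measure.smul_apply, ENNReal.ofReal_coe_nnreal]
    have : Measure.map L (volume : Measure (ℝ × ℝ)) S = volume (L ⁻¹' S) :=
      L.toHomeomorph.toMeasurableEquiv.map_apply S
    rw [this]
    rfl


/-- Directional derivative. -/
def dirD (u : ℝ × ℝ) (g : ℝ × ℝ → ℝ) : ℝ × ℝ → ℝ := fun p => fderiv ℝ g p u

theorem dirD_analytic (u : ℝ × ℝ) {g : ℝ × ℝ → ℝ} {V : Set (ℝ × ℝ)}
    (hg : AnalyticOnNhd ℝ g V) : AnalyticOnNhd ℝ (dirD u g) V := by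
  intro p hp
  exact ((ContinuousLinearMap.apply ℝ ℝ u).analyticAt _).comp (hg.fderiv p hp)

theorem dirD_iter_analytic (u : ℝ × ℝ) {g : ℝ × ℝ → ℝ} {V : Set (ℝ × ℝ)}
    (hg : AnalyticOnNhd ℝ g V) (n : ℕ) : AnalyticOnNhd ℝ ((dirD u)^[n] g) V := by
  induction n with
  | zero => simpa
  | succ n ih =>
    rw [Function.iterate_succ_apply']
    exact dirD_analytic u ih

theorem exists_equiv_dir {F : Type*} [NormedAddCommGroup F] [NormedSpace ℝ F]
    [FiniteDimensional ℝ F] (hF : Module.finrank ℝ F = 2) (u : F) (hu : u ≠ 0) :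
    ∃ L : (ℝ × ℝ) ≃L[ℝ] F, L (0, 1) = u := by
  obtain ⟨w, hw⟩ := exists_linearIndependent_pair_of_one_lt_finrank (R := ℝ)
    (by rw [hF]; norm_num) hu
  let f : (ℝ × ℝ) →ₗ[ℝ] F := (LinearMap.fst ℝ ℝ ℝ).smulRight w + (LinearMap.snd ℝ ℝ ℝ).smulRight u
  have hf : Function.Injective f := by
    rw [injective_iff_map_eq_zero]
    rintro ⟨s, t⟩ h
    have h' : t • u + s • w = 0 := by
      rw [add_comm]; simpa [f] using h
    obtain ⟨h1, h2⟩ := LinearIndependent.pair_iff.1 hw t s h'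
    simp [h1, h2]
  refine ⟨(LinearMap.linearEquivOfInjective f hf (by simp [hF])).toContinuousLinearEquiv, ?_⟩
  simp [f]

theorem line_hasDerivAt {g : ℝ × ℝ → ℝ} {q u : ℝ × ℝ} {s : ℝ}
    (hg : DifferentiableAt ℝ g (q + s • u)) :
    HasDerivAt (fun s : ℝ => g (q + s • u)) (dirD u g (q + s • u)) s := by
  have h1 : HasDerivAt (fun s : ℝ => q + s • u) u s := by
    simpa using ((hasDerivAt_id s).smul_const u).const_add q
  exact hg.hasFDerivAt.comp_hasDerivAt s h1

theorem exists_dir_order {V : Set (ℝ × ℝ)} (hV : IsOpen V) (hVc : Convex ℝ V) {D : ℝ × ℝ → ℝ}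
    (hD : AnalyticOnNhd ℝ D V) {q : ℝ × ℝ} (hq : q ∈ V) (hDq : D q ≠ 0) {p : ℝ × ℝ} (hp : p ∈ V) :
    ∃ u : ℝ × ℝ, u ≠ 0 ∧ ∃ n : ℕ, (dirD u)^[n] D p ≠ 0 := by
  by_cases hpq : p = q
  · exact ⟨(1, 0), by simp, 0, by simpa [hpq] using hDq⟩
  refine ⟨q - p, sub_ne_zero.2 (Ne.symm hpq), ?_⟩
  by_contra! hcon
  set u := q - p with hu
  have hcont : Continuous (fun s : ℝ => p + s • u) := by fun_prop
  have hI : IsOpen ((fun s : ℝ => p + s • u) ⁻¹' V) := hV.preimage hcont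
  have hc : Convex ℝ ((fun s : ℝ => p + s • u) ⁻¹' V) := by
    intro s hs t ht a b ha hb hab
    have := hVc hs ht ha hb hab
    simp only [mem_preimage] at *
    convert this using 1
    have : p = a • p + b • p := by rw [← add_smul, hab, one_smul]
    conv_lhs => rw [this]
    simp only [smul_add, smul_smul, add_smul, smul_eq_mul]
    abel
  have := chain_zero _ hI hc.isPreconnected (fun j s => (dirD u)^[j] D (p + s • u)) (by
      intro s hs
      have h1 : AnalyticAt ℝ D (p + s • u) := hD _ hs
      have h2 : AnalyticAt ℝ (fun s : ℝ => p + s • u) s := by fun_prop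
      exact AnalyticAt.fun_comp (f := fun s : ℝ => p + s • u) h1 h2)
    (by
      intro j s hs
      simp only [Function.iterate_succ_apply']
      exact line_hasDerivAt ((dirD_iter_analytic u hD j _ hs).differentiableAt))
    0 (by simpa using hp) (by intro j; simpa using hcon j) 1 (by simpa [hu] using hq)
  apply hDq
  simpa [hu] using this

theorem sublevel_local {V : Set (ℝ × ℝ)} (hV : IsOpen V) {D : ℝ × ℝ → ℝ}
    (hD : AnalyticOnNhd ℝ D V) {p : ℝ × ℝ} (hp : p ∈ V) {u : ℝ × ℝ} (hu : u ≠ 0) {n : ℕ}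
    (hn : (dirD u)^[n] D p ≠ 0) :
    ∃ r > 0, ∃ C : ℝ, 0 ≤ C ∧ ∀ ρ : ℝ, 0 < ρ → ρ ≤ 1 →
      volume {x ∈ Metric.ball p r | |D x| < ρ ^ (n+1)} ≤ ENNReal.ofReal (C * ρ) := by
  set g := (dirD u)^[n] D with hg
  have hga := dirD_iter_analytic u hD n
  set lam := |g p| / 2 with hlam
  have hl : 0 < lam := by positivity
  have hcont : ContinuousAt g p := (hga p hp).continuousAt
  obtain ⟨r1, hr1, h1⟩ := Metric.continuousAt_iff.1 hcont lam hl
  obtain ⟨r2, hr2, h2⟩ := Metric.isOpen_iff.1 hV p hp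
  set r := min r1 r2 with hr
  have hr0 : 0 < r := lt_min hr1 hr2
  obtain ⟨L, hL⟩ := exists_equiv_dir (F := ℝ × ℝ) (by simp) u hu
  obtain ⟨C0, hC0, hC⟩ := haar_compare (volume : Measure (ℝ × ℝ)) L
  have hbV : Metric.ball p r ⊆ V := (Metric.ball_subset_ball (min_le_right _ _)).trans h2
  have hsgn : (∀ x ∈ Metric.ball p r, lam ≤ g x) ∨ (∀ x ∈ Metric.ball p r, g x ≤ - lam) := by
    have hx : ∀ x ∈ Metric.ball p r, |g x - g p| < lam := fun x hx => by
      have := h1 (lt_of_lt_of_le (Metric.mem_ball.1 hx) (min_le_left _ _))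
      rwa [Real.dist_eq] at this
    rcases lt_or_gt_of_ne hn with h | h
    · right
      intro x hx'
      have := abs_lt.1 (hx x hx')
      rw [abs_of_neg h] at hlam
      linarith
    · left
      intro x hx'
      have := abs_lt.1 (hx x hx')
      rw [abs_of_pos h] at hlam
      linarith
  have hbdd : Bornology.IsBounded (L ⁻¹' Metric.ball p r) := by
    have : L ⁻¹' Metric.ball p r = L.symm '' Metric.ball p r :=
      (ContinuousLinearEquiv.image_symm_eq_preimage L _).symm
    rw [this]
    exact L.symm.lipschitz.isBounded_image Metric.isBounded_ball
  obtain ⟨R, hR⟩ := hbdd.subset_closedBall 0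
  have main : ∀ ρ : ℝ, 0 < ρ → volume {x ∈ Metric.ball p r | |D x| < lam * ρ ^ n} ≤
      ENNReal.ofReal (C0 * ((2 ^ (n+1) - 2) * (2 * |R|)) * ρ) := by
    intro ρ hρ
    set S := {x ∈ Metric.ball p r | |D x| < lam * ρ ^ n} with hS
    have hSo : IsOpen S := by
      have : ContinuousOn (fun x => |D x|) (Metric.ball p r) :=
        (hD.continuousOn.mono hbV).abs
      exact this.isOpen_inter_preimage Metric.isOpen_ball (isOpen_Iio (a := lam * ρ ^ n))
    have hp2 : (0:ℝ) ≤ (2 ^ (n+1) - 2) := by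
      have : (1:ℝ) ≤ 2 ^ n := one_le_pow₀ (by norm_num)
      rw [pow_succ]; linarith
    have hslice : ∀ t : ℝ, volume (Prod.mk t ⁻¹' (L ⁻¹' S)) ≤
        (Icc (-|R|) |R|).indicator (fun _ => ENNReal.ofReal ((2 ^ (n+1) - 2) * ρ)) t := by
      intro t
      by_cases ht : t ∈ Icc (-|R|) |R|
      · rw [indicator_of_mem ht]
        have hlin : ∀ s : ℝ, L (t, s) = L (t, 0) + s • u := by
          intro s
          rw [← hL, ← map_smul, ← map_add]; simp
        have hIc : Convex ℝ {s : ℝ | L (t, 0) + s • u ∈ Metric.ball p r} := by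
          intro s hs s' hs' a b ha hb hab
          have := convex_ball p r hs hs' ha hb hab
          simp only [mem_ofPred_eq] at *
          convert this using 1
          have : L (t, 0) = a • L (t, 0) + b • L (t, 0) := by rw [← add_smul, hab, one_smul]
          conv_lhs => rw [this]
          simp only [smul_add, smul_smul, add_smul, smul_eq_mul]
          abel
        have := sublevel_one_dim_abs n _ hIc
          (fun j s => (dirD u)^[j] D (L (t, 0) + s • u)) lam ρ hl hρ (by
            intro j s hs
            simp only [Function.iterate_succ_apply']
            exact (line_hasDerivAt
              ((dirD_iter_analytic u hD j _ (hbV hs)).differentiableAt)).hasDerivWithinAt)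
          (by
            rcases hsgn with h | h
            · exact Or.inl fun s hs => h _ hs
            · exact Or.inr fun s hs => h _ hs)
        refine le_trans (measure_mono ?_) this
        intro s hs
        simp only [mem_preimage] at hs
        rw [hlin] at hs
        exact hs
      · rw [indicator_of_notMem ht]
        have : Prod.mk t ⁻¹' (L ⁻¹' S) = ∅ := by
          ext s
          simp only [mem_preimage, mem_empty_iff_false, iff_false]
          intro hs
          apply ht
          have : (t, s) ∈ Metric.closedBall (0 : ℝ × ℝ) R := hR hs.1
          rw [mem_closedBall_zero_iff, Prod.norm_mk, max_le_iff, Real.norm_eq_abs] at this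
          exact abs_le.1 (this.1.trans (le_abs_self _))
        rw [this]; simp
    calc volume S ≤ ENNReal.ofReal C0 * volume (L ⁻¹' S) := hC S
      _ = ENNReal.ofReal C0 * ∫⁻ t, volume (Prod.mk t ⁻¹' (L ⁻¹' S)) := by
          rw [Measure.volume_eq_prod, Measure.prod_apply (hSo.preimage L.continuous).measurableSet]
      _ ≤ ENNReal.ofReal C0 * ∫⁻ t, (Icc (-|R|) |R|).indicator
            (fun _ => ENNReal.ofReal ((2 ^ (n+1) - 2) * ρ)) t := by
          gcongr with t
          exact hslice t
      _ = ENNReal.ofReal C0 * (ENNReal.ofReal ((2 ^ (n+1) - 2) * ρ) *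
            ENNReal.ofReal (2 * |R|)) := by
          rw [lintegral_indicator measurableSet_Icc, setLIntegral_const, Real.volume_Icc]
          congr 3; ring
      _ = _ := by
          rw [← ENNReal.ofReal_mul (by positivity), ← ENNReal.ofReal_mul (by positivity)]
          congr 1; ring
  have hfin : volume (Metric.ball p r) ≠ ⊤ := Metric.isBounded_ball.measure_lt_top.ne
  have hp2 : (0:ℝ) ≤ (2 ^ (n+1) - 2) := by
    have : (1:ℝ) ≤ 2 ^ n := one_le_pow₀ (by norm_num)
    rw [pow_succ]; linarith
  refine ⟨r, hr0, C0 * ((2 ^ (n+1) - 2) * (2 * |R|)) +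
    (volume (Metric.ball p r)).toReal / lam, by positivity, fun ρ hρ hρ1 => ?_⟩
  by_cases h : ρ ≤ lam
  · refine (measure_mono ?_).trans ((main ρ hρ).trans (ENNReal.ofReal_le_ofReal ?_))
    · rintro x ⟨hx, hx2⟩
      refine ⟨hx, hx2.trans_le ?_⟩
      rw [pow_succ, mul_comm]
      gcongr
    · rw [add_mul]
      have : 0 ≤ (volume (Metric.ball p r)).toReal / lam * ρ := by positivity
      linarith
  · push Not at h
    calc volume {x ∈ Metric.ball p r | |D x| < ρ ^ (n+1)} ≤ volume (Metric.ball p r) :=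
          measure_mono fun x hx => hx.1
      _ = ENNReal.ofReal (volume (Metric.ball p r)).toReal := (ENNReal.ofReal_toReal hfin).symm
      _ ≤ _ := by
          apply ENNReal.ofReal_le_ofReal
          rw [add_mul]
          have h1 : (volume (Metric.ball p r)).toReal ≤
            (volume (Metric.ball p r)).toReal / lam * ρ := by
            rw [div_mul_eq_mul_div, le_div_iff₀ hl]
            gcongr
          have h2 : 0 ≤ C0 * ((2 ^ (n+1) - 2) * (2 * |R|)) * ρ := by positivity
          linarith

/-- Sublevel estimate for a nonzero analytic function of two variables. -/
theorem sublevel_two_dim {V : Set (ℝ × ℝ)} (hV : IsOpen V) (hVc : Convex ℝ V) {D : ℝ × ℝ → ℝ}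
    (hD : AnalyticOnNhd ℝ D V) {q : ℝ × ℝ} (hq : q ∈ V) (hDq : D q ≠ 0) {K : Set (ℝ × ℝ)}
    (hK : IsCompact K) (hKV : K ⊆ V) :
    ∃ n : ℕ, 1 ≤ n ∧ ∃ C : ℝ, 0 ≤ C ∧ ∀ ρ : ℝ, 0 < ρ → ρ ≤ 1 →
      volume {x ∈ K | |D x| < ρ ^ n} ≤ ENNReal.ofReal (C * ρ) := by
  refine hK.induction_on (p := fun K => ∃ n : ℕ, 1 ≤ n ∧ ∃ C : ℝ, 0 ≤ C ∧ ∀ ρ : ℝ, 0 < ρ → ρ ≤ 1 →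
      volume {x ∈ K | |D x| < ρ ^ n} ≤ ENNReal.ofReal (C * ρ)) ?_ ?_ ?_ ?_
  · exact ⟨1, le_rfl, 0, le_rfl, fun ρ _ _ => by simp⟩
  · rintro s t hst ⟨n, hn, C, hC, h⟩
    refine ⟨n, hn, C, hC, fun ρ h1 h2 => (measure_mono ?_).trans (h ρ h1 h2)⟩
    exact fun x hx => ⟨hst hx.1, hx.2⟩
  · rintro s t ⟨n, hn, C, hC, h⟩ ⟨n', hn', C', hC', h'⟩
    refine ⟨max n n', hn.trans (le_max_left _ _), C + C', by positivity, fun ρ h1 h2 => ?_⟩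
    rw [add_mul, ENNReal.ofReal_add (by positivity) (by positivity)]
    refine le_trans ((measure_mono ?_).trans (measure_union_le _ _))
      (add_le_add (h ρ h1 h2) (h' ρ h1 h2))
    rintro x ⟨hx | hx, hx2⟩
    · exact Or.inl ⟨hx, hx2.trans_le (pow_le_pow_of_le_one h1.le h2 (le_max_left _ _))⟩
    · exact Or.inr ⟨hx, hx2.trans_le (pow_le_pow_of_le_one h1.le h2 (le_max_right _ _))⟩
  · intro p hp
    obtain ⟨u, hu, n, hn⟩ := exists_dir_order hV hVc hD hq hDq (hKV hp)
    obtain ⟨r, hr, C, hC, h⟩ := sublevel_local hV hD (hKV hp) hu hn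
    exact ⟨Metric.ball p r, mem_nhdsWithin_of_mem_nhds (Metric.ball_mem_nhds p hr), n+1, by omega,
      C, hC, h⟩


/-- The numerators of the iterated derivatives of `a` along the level curves of `φ`. -/
def Pj (φ a : ℝ × ℝ → ℝ) : ℕ → ℝ × ℝ → ℝ
  | 0 => a
  | j + 1 => fun p =>
      dirD (0, 1) φ p * (dirD (0, 1) φ p * dirD (1, 0) (Pj φ a j) p
        - dirD (1, 0) φ p * dirD (0, 1) (Pj φ a j) p)
      - 2 * j * Pj φ a j p * (dirD (0, 1) φ p * dirD (1, 0) (dirD (0, 1) φ) p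
        - dirD (1, 0) φ p * dirD (0, 1) (dirD (0, 1) φ) p)

theorem Pj_analytic {φ a : ℝ × ℝ → ℝ} {V : Set (ℝ × ℝ)} (hφ : AnalyticOnNhd ℝ φ V)
    (ha : AnalyticOnNhd ℝ a V) (j : ℕ) : AnalyticOnNhd ℝ (Pj φ a j) V := by
  induction j with
  | zero => exact ha
  | succ j ih =>
    intro p hp
    have h1 := dirD_analytic (0, 1) hφ p hp
    have h2 := dirD_analytic (1, 0) hφ p hp
    have h3 := dirD_analytic (1, 0) ih p hp
    have h4 := dirD_analytic (0, 1) ih p hp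
    have h5 := dirD_analytic (1, 0) (dirD_analytic (0, 1) hφ) p hp
    have h6 := dirD_analytic (0, 1) (dirD_analytic (0, 1) hφ) p hp
    have h7 := ih p hp
    exact (h1.mul ((h1.mul h3).sub (h2.mul h4))).sub
      ((analyticAt_const.mul h7).mul ((h1.mul h5).sub (h2.mul h6)))

theorem curve_deriv {g : ℝ × ℝ → ℝ} {c : ℝ → ℝ} {c' : ℝ} {s : Set ℝ} {x : ℝ}
    (hc : HasDerivWithinAt c c' s x) (hg : DifferentiableAt ℝ g (x, c x)) :
    HasDerivWithinAt (fun x => g (x, c x))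
      (dirD (1, 0) g (x, c x) + c' * dirD (0, 1) g (x, c x)) s x := by
  have h1 : HasDerivWithinAt (fun x => (x, c x)) (1, c') s x := (hasDerivWithinAt_id x s).prodMk hc
  have h2 := hg.hasFDerivAt.comp_hasDerivWithinAt x h1
  have : ((1 : ℝ), c') = (1, 0) + c' • ((0 : ℝ), (1 : ℝ)) := by simp
  rw [this, map_add, map_smul] at h2
  exact h2

theorem Pj_chain {φ a : ℝ × ℝ → ℝ} {c : ℝ → ℝ} {s : Set ℝ} {x : ℝ} (j : ℕ)
    (hc : HasDerivWithinAt c (-(dirD (1, 0) φ (x, c x)) / dirD (0, 1) φ (x, c x)) s x)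
    (hP : DifferentiableAt ℝ (Pj φ a j) (x, c x))
    (hy : DifferentiableAt ℝ (dirD (0, 1) φ) (x, c x))
    (hne : dirD (0, 1) φ (x, c x) ≠ 0) :
    HasDerivWithinAt (fun x => Pj φ a j (x, c x) / dirD (0, 1) φ (x, c x) ^ (2 * j))
      (Pj φ a (j+1) (x, c x) / dirD (0, 1) φ (x, c x) ^ (2 * (j + 1))) s x := by
  have h1 := curve_deriv hc hP
  have h2 := curve_deriv hc hy
  have h3 := h1.fun_div (h2.fun_pow (2 * j)) (pow_ne_zero _ hne)
  refine h3.congr_deriv ?_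
  simp only [Pj]
  generalize dirD (0, 1) φ (x, c x) = A at *
  rcases j with _ | j
  · field_simp
    simp
    ring
  · have e1 : 2 * (j + 1) - 1 = 2 * j + 1 := by omega
    rw [e1]
    push_cast
    field_simp
    ring

theorem exists_det_ne_zero {V : Set (ℝ × ℝ)} (hV : IsOpen V) {N : ℕ}
    {a : Fin N → ℝ × ℝ → ℝ} (ha : ∀ k, AnalyticOnNhd ℝ (a k) V)
    {φ : ℝ × ℝ → ℝ} (hφ : AnalyticOnNhd ℝ φ V) {p : ℝ × ℝ} (hp : p ∈ V)
    (hpy : dirD (0, 1) φ p ≠ 0)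
    (hMain : ∀ U : Set (ℝ × ℝ), U ⊆ V → IsOpen U → U.Nonempty →
      ∀ f : Fin N → ℝ → ℝ, (∀ k, AnalyticOnNhd ℝ (f k) (φ '' U)) →
      (∀ x ∈ U, ∑ k, a k x * f k (φ x) = 0) →
      ∀ k, ∀ y ∈ φ '' U, f k y = 0) :
    ∃ j : Fin N → ℕ, ∃ q ∈ V, (Matrix.of fun i k => Pj φ (a k) (j i) q).det ≠ 0 := by
  by_contra! hcon
  set Φ : ℝ × ℝ → ℝ × ℝ := fun q => (q.1, φ q) with hΦ
  have hΦa : AnalyticAt ℝ Φ p := analyticAt_fst.prod (hφ p hp)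
  have hfd : fderiv ℝ Φ p = (ContinuousLinearMap.fst ℝ ℝ ℝ).prod (fderiv ℝ φ p) :=
    ((ContinuousLinearMap.fst ℝ ℝ ℝ).hasFDerivAt.prodMk
      (hφ p hp).differentiableAt.hasFDerivAt).fderiv
  have hinj : Function.Injective ((fderiv ℝ Φ p : (ℝ × ℝ) →L[ℝ] (ℝ × ℝ)) : (ℝ × ℝ) →ₗ[ℝ] (ℝ × ℝ)) := by
    rw [injective_iff_map_eq_zero]
    rintro ⟨s, t⟩ h
    rw [hfd] at h
    simp only [ContinuousLinearMap.coe_coe, ContinuousLinearMap.prod_apply,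
      ContinuousLinearMap.coe_fst', Prod.mk_eq_zero] at h
    obtain ⟨rfl, h2⟩ := h
    have e : ((0 : ℝ), t) = t • ((0 : ℝ), (1 : ℝ)) := by simp
    rw [e, map_smul, smul_eq_mul] at h2
    rcases mul_eq_zero.1 h2 with h | h
    · simp [h]
    · exact absurd h hpy
  let i : (ℝ × ℝ) ≃L[ℝ] (ℝ × ℝ) := (LinearEquiv.ofInjectiveEndo _ hinj).toContinuousLinearEquiv
  have hi : fderiv ℝ Φ p = (i : (ℝ × ℝ) →L[ℝ] (ℝ × ℝ)) := by
    apply ContinuousLinearMap.ext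
    intro z
    rfl
  have hst : HasStrictFDerivAt Φ (i : (ℝ × ℝ) →L[ℝ] (ℝ × ℝ)) p := by
    rw [← hi]; exact hΦa.hasStrictFDerivAt
  let e := hst.toOpenPartialHomeomorph Φ
  have he : (e : ℝ × ℝ → ℝ × ℝ) = Φ := hst.toOpenPartialHomeomorph_coe
  have hpe : p ∈ e.source := hst.mem_toOpenPartialHomeomorph_source
  have hsa : AnalyticAt ℝ e.symm (Φ p) := by
    have := e.analyticAt_symm' hpe (by rw [he]; exact hΦa) (by rw [he]; exact hi)
    rwa [he] at this
  have hsp : e.symm (Φ p) = p := by rw [← he]; exact e.left_inv hpe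
  have hV' : ∀ᶠ q in nhds p, q ∈ V ∧ dirD (0, 1) φ q ≠ 0 :=
    (hV.eventually_mem hp).and
      ((dirD_analytic (0, 1) hφ p hp).continuousAt.eventually_ne hpy)
  have hev : ∀ᶠ z in nhds (Φ p), AnalyticAt ℝ e.symm z ∧ z ∈ e.target ∧
      (e.symm z ∈ V ∧ dirD (0, 1) φ (e.symm z) ≠ 0) := by
    refine hsa.eventually_analyticAt.and ((e.open_target.eventually_mem ?_).and ?_)
    · have := e.map_source hpe
      rwa [he] at this
    · have := hsa.continuousAt.tendsto
      rw [hsp] at this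
      exact this.eventually hV'
  obtain ⟨r, hr, hball⟩ := Metric.eventually_nhds_iff_ball.1 hev
  set x0 := p.1 with hx0
  set t0 := φ p with ht0
  have hbox : ∀ x ∈ Metric.ball x0 r, ∀ t ∈ Metric.ball t0 r, (x, t) ∈ Metric.ball (Φ p) r := by
    intro x hx t ht
    rw [← ball_prod_same]
    exact ⟨hx, ht⟩
  have hr1 : ∀ z ∈ Metric.ball (Φ p) r, (e.symm z).1 = z.1 ∧ φ (e.symm z) = z.2 := by
    intro z hz
    have := e.right_inv (hball z hz).2.1
    rw [he] at this
    have w1 := congrArg (fun w : ℝ × ℝ => w.1) this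
    have w2 := congrArg (fun w : ℝ × ℝ => w.2) this
    exact ⟨w1, w2⟩
  set c : ℝ → ℝ → ℝ := fun t x => (e.symm (x, t)).2 with hc
  have hκ : ∀ x ∈ Metric.ball x0 r, ∀ t ∈ Metric.ball t0 r, e.symm (x, t) = (x, c t x) := by
    intro x hx t ht
    exact Prod.ext (hr1 _ (hbox x hx t ht)).1 rfl
  let T : Set ℝ := Metric.ball t0 r
  have hx0m : x0 ∈ Metric.ball x0 r := Metric.mem_ball_self hr
  -- the ring of analytic functions
  let S : Subring (T → ℝ) :=
    { carrier := {g | ∃ f : ℝ → ℝ, AnalyticOnNhd ℝ f T ∧ ∀ t : T, g t = f t}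
      mul_mem' := by
        rintro g g' ⟨f, hf, h⟩ ⟨f', hf', h'⟩
        exact ⟨fun t => f t * f' t, hf.mul hf', fun t => by simp [h, h']⟩
      one_mem' := ⟨fun _ => 1, analyticOnNhd_const, fun t => rfl⟩
      add_mem' := by
        rintro g g' ⟨f, hf, h⟩ ⟨f', hf', h'⟩
        exact ⟨fun t => f t + f' t, hf.add hf', fun t => by simp [h, h']⟩
      zero_mem' := ⟨fun _ => 0, analyticOnNhd_const, fun t => rfl⟩
      neg_mem' := by
        rintro g ⟨f, hf, h⟩
        exact ⟨fun t => - f t, hf.neg, fun t => by simp [h]⟩ }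
  have hTn : Nonempty T := ⟨⟨t0, Metric.mem_ball_self hr⟩⟩
  let A : ℕ → Fin N → S := fun j k =>
    ⟨fun t => Pj φ (a k) j (e.symm (x0, t)), fun t => Pj φ (a k) j (e.symm (x0, t)), by
      intro t ht
      have hb := hball _ (hbox x0 hx0m t ht)
      have h1 := Pj_analytic hφ (ha k) j _ hb.2.2.1
      have h2 : AnalyticAt ℝ (fun t : ℝ => (x0, t)) t := analyticAt_const.prod analyticAt_id
      have h3 : AnalyticAt ℝ (fun t : ℝ => e.symm (x0, t)) t :=
        AnalyticAt.fun_comp (f := fun t : ℝ => (x0, t)) hb.1 h2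
      exact AnalyticAt.fun_comp (f := fun t : ℝ => e.symm (x0, t)) h1 h3, fun t => rfl⟩
  rcases det_or_relation N A with ⟨j, hj⟩ | ⟨v, hv, hv2⟩
  · apply hj
    apply Subtype.ext
    funext t
    have h1 := hcon j _ (hball _ (hbox x0 hx0m t t.2)).2.2.1
    let ev : S →+* ℝ := (Pi.evalRingHom (fun _ : T => ℝ) t).comp S.subtype
    have h2 : ev (Matrix.of fun i k => A (j i) k).det = 0 := by
      rw [RingHom.map_det, ← h1]
      congr 1
    exact h2
  · choose f hf hfv using fun k => (v k).2
    have hUo : IsOpen (e.source ∩ e ⁻¹' (Metric.ball (Φ p) r)) :=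
      e.isOpen_inter_preimage Metric.isOpen_ball
    set U := e.source ∩ e ⁻¹' (Metric.ball (Φ p) r) with hU
    have hUb : ∀ q ∈ U, Φ q ∈ Metric.ball (Φ p) r ∧ e.symm (Φ q) = q := by
      rintro q ⟨h1, h2⟩
      refine ⟨by rwa [mem_preimage, he] at h2, ?_⟩
      rw [← he]; exact e.left_inv h1
    have hUT : φ '' U ⊆ T := by
      rintro _ ⟨q, hq, rfl⟩
      have := (hUb q hq).1
      rw [← ball_prod_same] at this
      exact this.2
    have hTU : ∀ t ∈ T, t ∈ φ '' U := by
      intro t ht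
      have hb := hbox x0 hx0m t ht
      refine ⟨e.symm (x0, t), ⟨e.map_target (hball _ hb).2.1, ?_⟩, (hr1 _ hb).2⟩
      rw [mem_preimage, e.right_inv (hball _ hb).2.1]
      exact hb
    have hUV : U ⊆ V := by
      intro q hq
      have := hUb q hq
      have h2 := (hball _ this.1).2.2.1
      rwa [this.2] at h2
    have hrel : ∀ j, ∀ t ∈ T, ∑ k, Pj φ (a k) j (e.symm (x0, t)) * f k t = 0 := by
      intro j t ht
      have h1 := congrArg (fun g : S => (g : T → ℝ) ⟨t, ht⟩) (hv2 j)
      have h2 : ((∑ k, A j k * v k : S) : T → ℝ) ⟨t, ht⟩ =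
          ∑ k, (A j k : T → ℝ) ⟨t, ht⟩ * (v k : T → ℝ) ⟨t, ht⟩ := by
        simp
      have h3 := h2.symm.trans h1
      rw [show ((0 : S) : T → ℝ) ⟨t, ht⟩ = 0 from rfl] at h3
      clear h1
      rename' h3 => h1
      simp only [hfv] at h1
      exact h1
    have hzero : ∀ q ∈ U, ∑ k, a k q * f k (φ q) = 0 := by
      intro q hq
      obtain ⟨hqb, hqs⟩ := hUb q hq
      rw [← ball_prod_same] at hqb
      obtain ⟨hqx, hqt⟩ := hqb
      set t := φ q with ht
      have hqt' : t ∈ Metric.ball t0 r := hqt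
      have hcan : ∀ x ∈ Metric.ball x0 r, AnalyticAt ℝ (c t) x := by
        intro x hx
        have hb := (hball _ (hbox x hx t hqt')).1
        have h2 : AnalyticAt ℝ (fun x : ℝ => (x, t)) x := analyticAt_id.prod analyticAt_const
        exact analyticAt_snd.comp (AnalyticAt.fun_comp (f := fun x : ℝ => (x, t)) hb h2)
      have hmem : ∀ x ∈ Metric.ball x0 r, (x, c t x) ∈ V ∧ dirD (0, 1) φ (x, c t x) ≠ 0 := by
        intro x hx
        have hb := (hball _ (hbox x hx t hqt')).2.2
        rwa [hκ x hx t hqt'] at hb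
      have hcd : ∀ x ∈ Metric.ball x0 r, HasDerivAt (c t)
          (-(dirD (1, 0) φ (x, c t x)) / dirD (0, 1) φ (x, c t x)) x := by
        intro x hx
        have hd := (hcan x hx).differentiableAt.hasDerivAt
        have h1 := curve_deriv (s := univ) hd.hasDerivWithinAt
          (hφ _ (hmem x hx).1).differentiableAt
        rw [hasDerivWithinAt_univ] at h1
        have h2 : (fun x => φ (x, c t x)) =ᶠ[nhds x] fun _ => t := by
          filter_upwards [Metric.isOpen_ball.mem_nhds hx] with y hy
          rw [← hκ y hy t hqt']
          exact (hr1 _ (hbox y hy t hqt')).2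
        have h3 := h1.unique ((hasDerivAt_const x t).congr_of_eventuallyEq h2)
        have h4 : deriv (c t) x = -(dirD (1, 0) φ (x, c t x)) / dirD (0, 1) φ (x, c t x) := by
          rw [eq_div_iff (hmem x hx).2]; linarith
        rwa [h4] at hd
      have hz := chain_zero (Metric.ball x0 r) Metric.isOpen_ball
        (convex_ball x0 r).isPreconnected
        (fun j x => ∑ k, Pj φ (a k) j (x, c t x) / dirD (0, 1) φ (x, c t x) ^ (2 * j) * f k t)
        (by
          intro x hx
          have h3 : AnalyticAt ℝ (fun x : ℝ => (x, c t x)) x := analyticAt_id.prod (hcan x hx)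
          simp only [mul_zero, pow_zero, div_one]
          apply Finset.analyticAt_fun_sum
          intro k _
          exact (AnalyticAt.fun_comp (f := fun x : ℝ => (x, c t x)) (ha k _ (hmem x hx).1) h3).mul
            analyticAt_const)
        (by
          intro j x hx
          apply HasDerivAt.fun_sum
          intro k _
          apply HasDerivAt.mul_const
          rw [← hasDerivWithinAt_univ]
          exact Pj_chain j (hcd x hx).hasDerivWithinAt
            (Pj_analytic hφ (ha k) j _ (hmem x hx).1).differentiableAt
            (dirD_analytic _ hφ _ (hmem x hx).1).differentiableAt (hmem x hx).2)
        x0 hx0m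
        (by
          intro j
          have h1 := hrel j t hqt
          rw [hκ x0 hx0m t hqt'] at h1
          simp only [div_mul_eq_mul_div, ← Finset.sum_div, h1, zero_div])
        q.1 hqx
      simp only [mul_zero, pow_zero, div_one] at hz
      have : (q.1, c t q.1) = q := by
        rw [← hκ q.1 hqx t hqt']; exact hqs
      rw [this] at hz
      exact hz
    have hfin := hMain U hUV hUo
      (by obtain ⟨q, hq, _⟩ := hTU t0 (Metric.mem_ball_self hr); exact ⟨q, hq⟩)
      f (fun k => (hf k).mono hUT) hzero
    apply hv
    funext k
    apply Subtype.ext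
    funext t
    rw [hfv k t, hfin k t (hTU t t.2)]
    rfl


theorem curve_exists {φ : ℝ × ℝ → ℝ} {V : Set (ℝ × ℝ)} (hφ : AnalyticOnNhd ℝ φ V)
    {x1 y1 xm xM b L : ℝ} (hx : x1 ∈ Icc xm xM) (hb : 0 ≤ b) (hL0 : 0 ≤ L)
    (hZ : Icc xm xM ×ˢ Metric.closedBall y1 b ⊆ V)
    (hne : ∀ p ∈ Icc xm xM ×ˢ Metric.closedBall y1 b, dirD (0, 1) φ p ≠ 0)
    (hL : ∀ p ∈ Icc xm xM ×ˢ Metric.closedBall y1 b,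
      |-(dirD (1, 0) φ p) / dirD (0, 1) φ p| ≤ L)
    (hlen : L * (xM - xm) ≤ b) :
    ∃ c : ℝ → ℝ, c x1 = y1 ∧ (∀ x ∈ Icc xm xM, |c x - y1| ≤ b) ∧
      (∀ x ∈ Icc xm xM, HasDerivWithinAt c
        (-(dirD (1, 0) φ (x, c x)) / dirD (0, 1) φ (x, c x)) (Icc xm xM) x) ∧
      ∀ x ∈ Icc xm xM, φ (x, c x) = φ (x1, y1) := by
  lift b to NNReal using hb
  lift L to NNReal using hL0
  set Z := Icc xm xM ×ˢ Metric.closedBall y1 (b : ℝ) with hZdef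
  set F : ℝ × ℝ → ℝ := fun p => -(dirD (1, 0) φ p) / dirD (0, 1) φ p with hF
  have hFa : AnalyticOnNhd ℝ F Z := fun p hp =>
    (dirD_analytic (1, 0) hφ p (hZ hp)).neg.div (dirD_analytic (0, 1) hφ p (hZ hp)) (hne p hp)
  have hZc : IsCompact Z := isCompact_Icc.prod (isCompact_closedBall _ _)
  have hZconv : Convex ℝ Z := (convex_Icc _ _).prod (convex_closedBall _ _)
  have hFcd : ContDiffOn ℝ 1 F Z := fun p hp => (hFa p hp).contDiffAt.contDiffWithinAt
  obtain ⟨Kc, hKc⟩ := hFcd.exists_lipschitzOnWith (by norm_num) hZconv hZc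
  have hpl : IsPicardLindelof (fun x y => F (x, y)) (⟨x1, hx⟩ : Icc xm xM) y1
      b 0 L Kc := by
    refine ⟨?_, ?_, ?_, ?_⟩
    · intro t ht
      refine LipschitzOnWith.of_dist_le_mul fun y hy y' hy' => ?_
      have := hKc.dist_le_mul (t, y) ⟨ht, hy⟩ (t, y') ⟨ht, hy'⟩
      simpa [Prod.dist_eq] using this
    · intro y hy
      exact hFcd.continuousOn.comp (by fun_prop) (fun t ht => ⟨ht, hy⟩)
    · intro t ht y hy
      exact hL (t, y) ⟨ht, hy⟩
    · have h1 : max (xM - x1) (x1 - xm) ≤ xM - xm :=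
        max_le (by linarith [hx.1]) (by linarith [hx.2])
      have := mul_le_mul_of_nonneg_left h1 L.coe_nonneg
      simp only [NNReal.coe_zero, sub_zero]
      exact this.trans hlen
  have hy0 : y1 ∈ Metric.closedBall y1 ((0 : NNReal) : ℝ) := by simp
  obtain ⟨α, hα⟩ := ODE.FunSpace.exists_isFixedPt_next hpl hy0
  have hmem : ∀ x, α.compProj x ∈ Metric.closedBall y1 (b : ℝ) := fun x =>
    α.compProj_mem_closedBall hpl.mul_max_le
  have hder : ∀ x ∈ Icc xm xM, HasDerivWithinAt α.compProj (F (x, α.compProj x)) (Icc xm xM) x := by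
    intro x hxx
    refine (ODE.hasDerivWithinAt_picard_Icc (f := fun x y => F (x, y)) (u := Metric.closedBall y1 (b : ℝ))
      (t₀ := x1) hx hpl.continuousOn_uncurry
      α.continuous_compProj.continuousOn (fun t _ => hmem t) y1 hxx).congr_of_mem ?_ hxx
    intro t ht
    nth_rw 1 [← hα]
    rw [ODE.FunSpace.compProj_apply, ODE.FunSpace.next_apply, projIcc_of_mem _ ht]
  have hc0 : α.compProj x1 = y1 := by
    rw [← hα, ODE.FunSpace.compProj_apply, ODE.FunSpace.next_apply, projIcc_of_mem _ hx]
    simp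
  refine ⟨α.compProj, hc0, fun x _ => by simpa [Real.dist_eq] using hmem x, hder, ?_⟩
  have hd0 : ∀ x ∈ Icc xm xM, HasDerivWithinAt (fun x => φ (x, α.compProj x)) 0 (Icc xm xM) x := by
    intro x hxx
    have hz : (x, α.compProj x) ∈ Z := ⟨hxx, hmem x⟩
    have := curve_deriv (hder x hxx) (hφ _ (hZ hz)).differentiableAt
    convert this using 1
    have h2 := hne _ hz
    simp only [hF]
    field_simp
    ring
  intro x hxx
  have := (convex_Icc xm xM).norm_image_sub_le_of_norm_hasDerivWithin_le (C := 0) hd0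
    (by simp) hx hxx
  simp only [zero_mul, norm_le_zero_iff] at this
  rw [hc0] at this
  linarith


/-- The matrix of numerators. -/
def PMat {N : ℕ} (φ : ℝ × ℝ → ℝ) (a : Fin N → ℝ × ℝ → ℝ) (j : Fin N → ℕ) (q : ℝ × ℝ) :
    Matrix (Fin N) (Fin N) ℝ := Matrix.of fun i k => Pj φ (a k) (j i) q

/-- Uniform bounds on a compact set. -/
structure Bd {N : ℕ} (φ : ℝ × ℝ → ℝ) (a : Fin N → ℝ × ℝ → ℝ) (j : Fin N → ℕ) (J : ℕ) (M : ℝ)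
    (V K' : Set (ℝ × ℝ)) : Prop where
  hφ : AnalyticOnNhd ℝ φ V
  ha : ∀ k, AnalyticOnNhd ℝ (a k) V
  hKV : K' ⊆ V
  hM : 1 ≤ M
  hJ : ∀ i, j i ≤ J
  bx : ∀ p ∈ K', |dirD (1, 0) φ p| ≤ M
  bfy : ∀ p ∈ K', |dirD (0, 1) φ p| ≤ M
  bphi : ∀ p ∈ K', |φ p| ≤ M
  blip : ∀ p ∈ K', ‖fderiv ℝ (dirD (0, 1) φ) p‖ ≤ M
  bP : ∀ k, ∀ l ≤ J + 1, ∀ p ∈ K', |Pj φ (a k) l p| ≤ M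
  bdet : ∀ p ∈ K', |(PMat φ a j p).det| ≤ M
  badj : ∀ p ∈ K', ∀ i k, |(PMat φ a j p).adjugate i k| ≤ M

/-- Smallness of the parameter. -/
structure Sm (N J : ℕ) (M δ : ℝ) : Prop where
  pos : 0 < δ
  four : δ * 4 ≤ 1
  m : δ * M ≤ 1
  nm : δ * (N * M) ≤ 1
  nnm : δ * (2 * N * N * M) ≤ 1
  mJ : δ * M ^ (2 * J) ≤ 1

section
variable {N : ℕ} {φ : ℝ × ℝ → ℝ} {a : Fin N → ℝ × ℝ → ℝ} {j : Fin N → ℕ} {J : ℕ} {M δ : ℝ}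
  {V K' : Set (ℝ × ℝ)}

theorem lower_at (hB : Bd φ a j J M V K') (hS : Sm N J M δ) {q : ℝ × ℝ} (hq : q ∈ K')
    (hD : δ ≤ |dirD (0, 1) φ q * (PMat φ a j q).det|) :
    δ ^ 2 ≤ |dirD (0, 1) φ q| ∧ δ ^ 2 ≤ |(PMat φ a j q).det| := by
  rw [abs_mul] at hD
  have h1 := hB.bfy q hq
  have h2 := hB.bdet q hq
  have h3 := hS.pos
  have h4 := hS.m
  have h5 := hB.hM
  have key : ∀ u v : ℝ, 0 ≤ u → 0 ≤ v → v ≤ M → δ ≤ u * v → δ ^ 2 ≤ u := by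
    intro u v hu hv hvM huv
    have h6 : δ ≤ u * M := huv.trans (mul_le_mul_of_nonneg_left hvM hu)
    have h7 : δ * δ ≤ δ * (u * M) := mul_le_mul_of_nonneg_left h6 h3.le
    have h8 : u * (δ * M) ≤ u * 1 := mul_le_mul_of_nonneg_left h4 hu
    nlinarith
  exact ⟨key _ _ (abs_nonneg _) (abs_nonneg _) h2 hD,
    key _ _ (abs_nonneg _) (abs_nonneg _) h1 (by rwa [mul_comm])⟩

theorem pow_small (hS : Sm N J M δ) : δ ^ 4 ≤ δ := by
  have h3 := hS.pos
  have h4 := hS.four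
  exact pow_le_of_le_one h3.le (by linarith) (by norm_num)

theorem lower_near (hB : Bd φ a j J M V K') (hS : Sm N J M δ) {q : ℝ × ℝ}
    (hqK : Metric.closedBall q δ ⊆ K')
    (hD : δ ≤ |dirD (0, 1) φ q * (PMat φ a j q).det|) {p : ℝ × ℝ}
    (hp : p ∈ Metric.closedBall q (δ ^ 4)) : p ∈ K' ∧ δ ^ 3 ≤ |dirD (0, 1) φ p| := by
  have h3 := hS.pos
  have hsub : Metric.closedBall q (δ ^ 4) ⊆ K' :=
    (Metric.closedBall_subset_closedBall (pow_small hS)).trans hqK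
  refine ⟨hsub hp, ?_⟩
  have hq0 : q ∈ Metric.closedBall q (δ ^ 4) := Metric.mem_closedBall_self (by positivity)
  have h1 := (lower_at hB hS (hsub hq0) hD).1
  have h2 := (convex_closedBall q (δ ^ 4)).norm_image_sub_le_of_norm_fderiv_le
    (𝕜 := ℝ) (f := dirD (0, 1) φ) (C := M)
    (fun z hz => (dirD_analytic (0, 1) hB.hφ z (hB.hKV (hsub hz))).differentiableAt)
    (fun z hz => hB.blip z (hsub hz)) hp hq0
  have h4 : ‖q - p‖ ≤ δ ^ 4 := by
    rw [← dist_eq_norm, dist_comm]; exact hp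
  have hM := hB.hM
  have h5 : M * ‖q - p‖ ≤ δ ^ 3 := by
    calc M * ‖q - p‖ ≤ M * δ ^ 4 := mul_le_mul_of_nonneg_left h4 (by linarith)
      _ = (δ * M) * δ ^ 3 := by ring
      _ ≤ 1 * δ ^ 3 := mul_le_mul_of_nonneg_right hS.m (by positivity)
      _ = δ ^ 3 := one_mul _
  have h6 : |dirD (0, 1) φ q| ≤ |dirD (0, 1) φ p| + δ ^ 3 := by
    have := abs_sub_abs_le_abs_sub (dirD (0, 1) φ q) (dirD (0, 1) φ p)
    rw [Real.norm_eq_abs] at h2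
    linarith
  have h7 : δ ^ 3 * 4 ≤ δ ^ 2 := by nlinarith [hS.four, sq_nonneg δ]
  have h8 : 0 < δ ^ 3 := by positivity
  linarith

theorem fiber_inj (hB : Bd φ a j J M V K') (hS : Sm N J M δ) {q : ℝ × ℝ}
    (hqK : Metric.closedBall q δ ⊆ K')
    (hD : δ ≤ |dirD (0, 1) φ q * (PMat φ a j q).det|) {x y y' : ℝ}
    (hp : (x, y) ∈ Metric.closedBall q (δ ^ 4)) (hp' : (x, y') ∈ Metric.closedBall q (δ ^ 4))
    (he : φ (x, y) = φ (x, y')) : y = y' := by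
  wlog hlt : y < y' generalizing y y'
  · rcases eq_or_lt_of_le (not_lt.1 hlt) with h | h
    · exact h.symm
    · exact (this hp' hp he.symm h).symm
  exfalso
  have hmem : ∀ z ∈ Icc y y', (x, z) ∈ Metric.closedBall q (δ ^ 4) := by
    intro z hz
    rw [Metric.mem_closedBall, Prod.dist_eq, max_le_iff, Real.dist_eq, Real.dist_eq] at hp hp' ⊢
    refine ⟨hp.1, ?_⟩
    rw [abs_le]
    have h1 := abs_le.1 hp.2
    have h2 := abs_le.1 hp'.2
    simp only at h1 h2 ⊢
    constructor <;> linarith [hz.1, hz.2]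
  have hder : ∀ z ∈ Icc y y', HasDerivAt (fun z => φ (x, z)) (dirD (0, 1) φ (x, z)) z := by
    intro z hz
    have h1 := (hB.hφ _ (hB.hKV (lower_near hB hS hqK hD (hmem z hz)).1)).differentiableAt.hasFDerivAt
    have h2 : HasDerivAt (fun z : ℝ => ((x, z) : ℝ × ℝ)) (0, 1) z :=
      (hasDerivAt_const z x).prodMk (hasDerivAt_id z)
    exact h1.comp_hasDerivAt z h2
  obtain ⟨z, hz, hz0⟩ := exists_hasDerivAt_eq_zero hlt
    (fun z hz => (hder z hz).continuousAt.continuousWithinAt) he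
    (fun z hz => hder z (Ioo_subset_Icc_self hz))
  have h1 := (lower_near hB hS hqK hD (hmem z (Ioo_subset_Icc_self hz))).2
  rw [hz0, abs_zero] at h1
  have := hS.pos
  have : 0 < δ ^ 3 := by positivity
  linarith

theorem cramer_lower (hB : Bd φ a j J M V K') (hS : Sm N J M δ) {q : ℝ × ℝ} (hq : q ∈ K')
    (hdet : δ ^ 2 ≤ |(PMat φ a j q).det|) {w : Fin N → ℝ} (hw : ∑ k, w k ^ 2 = 1) :
    ∃ i, δ ^ 3 ≤ |∑ k, Pj φ (a k) (j i) q * w k| := by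
  by_contra! hcon
  have h3 := hS.pos
  have hM := hB.hM
  set A := PMat φ a j q with hA
  have h1 : ∀ k, |A.det * w k| ≤ N * (M * δ ^ 3) := by
    intro k
    have h2 : A.det * w k = ∑ i, A.adjugate k i * (A.mulVec w) i := by
      have : (A.adjugate * A).mulVec w = A.det • w := by
        rw [Matrix.adjugate_mul, Matrix.smul_mulVec, Matrix.one_mulVec]
      have h4 := congrFun this k
      rw [← Matrix.mulVec_mulVec] at h4
      simp only [Pi.smul_apply, smul_eq_mul] at h4
      rw [← h4]; rfl
    rw [h2]
    calc |∑ i, A.adjugate k i * (A.mulVec w) i| ≤ ∑ i, |A.adjugate k i * (A.mulVec w) i| :=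
          Finset.abs_sum_le_sum_abs _ _
      _ ≤ ∑ i : Fin N, M * δ ^ 3 := by
          refine Finset.sum_le_sum fun i _ => ?_
          rw [abs_mul]
          exact mul_le_mul (hB.badj q hq k i) (hcon i).le (abs_nonneg _) (by linarith)
      _ = N * (M * δ ^ 3) := by simp
  have h5 : A.det ^ 2 ≤ N * (N * (M * δ ^ 3)) ^ 2 := by
    calc A.det ^ 2 = ∑ k, (A.det * w k) ^ 2 := by
          simp_rw [mul_pow]; rw [← Finset.mul_sum, hw, mul_one]
      _ ≤ ∑ k : Fin N, (N * (M * δ ^ 3)) ^ 2 := by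
          refine Finset.sum_le_sum fun k _ => ?_
          rw [← sq_abs (A.det * w k)]
          exact pow_le_pow_left₀ (abs_nonneg _) (h1 k) 2
      _ = _ := by simp
  have hNN : (N : ℝ) ≤ N ^ 2 := by
    have : N ≤ N ^ 2 := Nat.le_self_pow (by norm_num) N
    exact_mod_cast this
  have h6 : A.det ^ 2 ≤ (N * N * M * δ ^ 3) ^ 2 := by
    refine h5.trans ?_
    calc (N : ℝ) * (N * (M * δ ^ 3)) ^ 2 ≤ N ^ 2 * (N * (M * δ ^ 3)) ^ 2 :=
          mul_le_mul_of_nonneg_right hNN (by positivity)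
      _ = _ := by ring
  have h7 : |A.det| ≤ N * N * M * δ ^ 3 := by
    apply abs_le_of_sq_le_sq h6 (by positivity)
  have h8 : N * N * M * δ ^ 3 * 2 ≤ δ ^ 2 := by
    calc N * N * M * δ ^ 3 * 2 = (δ * (2 * N * N * M)) * δ ^ 2 := by ring
      _ ≤ 1 * δ ^ 2 := mul_le_mul_of_nonneg_right hS.nnm (by positivity)
      _ = _ := one_mul _
  have h9 : 0 < δ ^ 2 := by positivity
  linarith

end


section
variable {N : ℕ} {φ : ℝ × ℝ → ℝ} {a : Fin N → ℝ × ℝ → ℝ} {j : Fin N → ℕ} {J : ℕ} {M δ : ℝ}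
  {V K' : Set (ℝ × ℝ)}

theorem fiber_est (hB : Bd φ a j J M V K') (hS : Sm N J M δ) {x1 y1 : ℝ}
    (hqK : Metric.closedBall (x1, y1) δ ⊆ K')
    (hD : δ ≤ |dirD (0, 1) φ (x1, y1) * (PMat φ a j (x1, y1)).det|)
    {xm xM : ℝ} (hx1 : x1 ∈ Icc xm xM) (hlen : xM - xm ≤ δ ^ (6 * J + 12))
    {w : Fin N → ℝ} (hw : ∑ k, w k ^ 2 = 1) {ρ : ℝ} (hρ : 0 < ρ) (hρ1 : ρ ≤ 1)
    {E : ℝ} (hE : E ≤ δ ^ 5 * ρ ^ J) :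
    volume {x ∈ Icc xm xM | ∃ y, |y - y1| ≤ δ ^ 4 / 2 ∧ φ (x, y) = φ (x1, y1) ∧
      |∑ k, a k (x, y) * w k| < E} ≤ ENNReal.ofReal ((2 ^ (J + 1) - 2) * ρ) := by
  have h3 := hS.pos
  have h31 : δ ≤ 1 := by linarith [hS.four]
  have hM := hB.hM
  have hη4 : δ ^ (6 * J + 12) ≤ δ ^ 4 := pow_le_pow_of_le_one h3.le h31 (by omega)
  have hball : Icc xm xM ×ˢ Metric.closedBall y1 (δ ^ 4 / 2) ⊆
      Metric.closedBall (x1, y1) (δ ^ 4) := by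
    rintro ⟨x, y⟩ ⟨hx, hy⟩
    simp only [Metric.mem_closedBall, Prod.dist_eq, max_le_iff, Real.dist_eq] at hy ⊢
    have h4 : 0 < δ ^ 4 := by positivity
    refine ⟨abs_le.2 ⟨?_, ?_⟩, by linarith⟩ <;> linarith [hx.1, hx.2, hx1.1, hx1.2]
  have hnear := fun p hp => lower_near hB hS hqK hD (hball (a := p) hp)
  have hne : ∀ p ∈ Icc xm xM ×ˢ Metric.closedBall y1 (δ ^ 4 / 2), dirD (0, 1) φ p ≠ 0 := by
    intro p hp h0
    have := (hnear p hp).2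
    rw [h0, abs_zero] at this
    have : 0 < δ ^ 3 := by positivity
    linarith
  have hL : ∀ p ∈ Icc xm xM ×ˢ Metric.closedBall y1 (δ ^ 4 / 2),
      |-(dirD (1, 0) φ p) / dirD (0, 1) φ p| ≤ M / δ ^ 3 := by
    intro p hp
    rw [abs_div, abs_neg]
    exact div_le_div₀ (by linarith) (hB.bx p (hnear p hp).1) (by positivity) (hnear p hp).2
  have hLlen : M / δ ^ 3 * (xM - xm) ≤ δ ^ 4 / 2 := by
    have h4 : M / δ ^ 3 * (xM - xm) ≤ M / δ ^ 3 * δ ^ (6 * J + 12) :=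
      mul_le_mul_of_nonneg_left hlen (by positivity)
    have h5 : δ ^ (6 * J + 12) ≤ δ ^ 12 := pow_le_pow_of_le_one h3.le h31 (by omega)
    have h6 : M / δ ^ 3 * δ ^ (6 * J + 12) ≤ M / δ ^ 3 * δ ^ 12 :=
      mul_le_mul_of_nonneg_left h5 (by positivity)
    have h7 : M / δ ^ 3 * δ ^ 12 = (δ * M) * δ ^ 8 := by field_simp
    have h8 : (δ * M) * δ ^ 8 ≤ 1 * δ ^ 8 := mul_le_mul_of_nonneg_right hS.m (by positivity)
    have h9 : δ ^ 8 ≤ δ ^ 5 := pow_le_pow_of_le_one h3.le h31 (by omega)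
    have h10 : δ ^ 5 * 4 = (δ * 4) * δ ^ 4 := by ring
    have h11 : (δ * 4) * δ ^ 4 ≤ 1 * δ ^ 4 := mul_le_mul_of_nonneg_right hS.four (by positivity)
    have : 0 < δ ^ 5 := by positivity
    linarith
  obtain ⟨c, hc1, hcb, hcd, hcφ⟩ := curve_exists hB.hφ hx1 (by positivity)
    (L := M / δ ^ 3) (by positivity)
    (fun p hp => hB.hKV (hnear p hp).1) hne hL hLlen
  have hcZ : ∀ x ∈ Icc xm xM, (x, c x) ∈ Icc xm xM ×ˢ Metric.closedBall y1 (δ ^ 4 / 2) := by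
    intro x hx
    exact ⟨hx, by simpa [Real.dist_eq] using hcb x hx⟩
  set G : ℕ → ℝ → ℝ := fun l x =>
    ∑ k, Pj φ (a k) l (x, c x) / dirD (0, 1) φ (x, c x) ^ (2 * l) * w k with hG
  have hGd : ∀ l, ∀ x ∈ Icc xm xM, HasDerivWithinAt (G l) (G (l + 1) x) (Icc xm xM) x := by
    intro l x hx
    have hz := hcZ x hx
    have hV := hB.hKV (hnear _ hz).1
    apply HasDerivWithinAt.fun_sum
    intro k _
    exact (Pj_chain l (hcd x hx) (Pj_analytic hB.hφ (hB.ha k) l _ hV).differentiableAt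
      (dirD_analytic (0, 1) hB.hφ _ hV).differentiableAt (hne _ hz)).mul_const (w k)
  have hq1 : (x1, y1) ∈ K' := hqK (Metric.mem_closedBall_self h3.le)
  have hlow := lower_at hB hS hq1 hD
  obtain ⟨i, hi⟩ := cramer_lower hB hS hq1 hlow.2 hw
  set l := j i with hl
  have hlJ : l ≤ J := hB.hJ i
  have hG1 : δ ^ 4 ≤ |G l x1| := by
    have h4 : G l x1 = (∑ k, Pj φ (a k) l (x1, y1) * w k) / dirD (0, 1) φ (x1, y1) ^ (2 * l) := by
      simp only [hG, hc1, Finset.sum_div]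
      exact Finset.sum_congr rfl fun k _ => by ring
    rw [h4, abs_div, abs_pow, le_div_iff₀ (pow_pos (lt_of_lt_of_le (by positivity) hlow.1) _)]
    calc δ ^ 4 * |dirD (0, 1) φ (x1, y1)| ^ (2 * l) ≤ δ ^ 4 * M ^ (2 * J) := by
          refine mul_le_mul_of_nonneg_left ?_ (by positivity)
          exact (pow_le_pow_left₀ (abs_nonneg _) (hB.bfy _ hq1) _).trans
            (pow_le_pow_right₀ hM (by omega))
      _ = (δ * M ^ (2 * J)) * δ ^ 3 := by ring
      _ ≤ 1 * δ ^ 3 := mul_le_mul_of_nonneg_right hS.mJ (by positivity)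
      _ ≤ _ := by rw [one_mul]; exact hi
  have hwk : ∀ k, |w k| ≤ 1 := by
    intro k
    rw [← sq_le_one_iff_abs_le_one, ← hw]
    exact Finset.single_le_sum (f := fun k => w k ^ 2) (fun i _ => sq_nonneg _) (Finset.mem_univ k)
  have hGb : ∀ x ∈ Icc xm xM, ‖G (l + 1) x‖ ≤ 1 / δ ^ (6 * J + 7) := by
    intro x hx
    have hz := hcZ x hx
    have hn := hnear _ hz
    have hterm : ∀ k, |Pj φ (a k) (l + 1) (x, c x) / dirD (0, 1) φ (x, c x) ^ (2 * (l + 1)) * w k|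
        ≤ M / δ ^ (6 * J + 6) := by
      intro k
      rw [abs_mul, abs_div, abs_pow]
      have h4 : δ ^ (6 * J + 6) ≤ |dirD (0, 1) φ (x, c x)| ^ (2 * (l + 1)) := by
        calc δ ^ (6 * J + 6) ≤ δ ^ (3 * (2 * (l + 1))) :=
              pow_le_pow_of_le_one h3.le h31 (by omega)
          _ = (δ ^ 3) ^ (2 * (l + 1)) := by rw [pow_mul]
          _ ≤ _ := pow_le_pow_left₀ (by positivity) hn.2 _
      have h5 := div_le_div₀ (by linarith) (hB.bP k (l + 1) (by omega) _ hn.1) (by positivity) h4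
      calc _ ≤ M / δ ^ (6 * J + 6) * 1 := mul_le_mul h5 (hwk k) (abs_nonneg _) (by positivity)
        _ = _ := mul_one _
    calc ‖G (l + 1) x‖ ≤ ∑ k : Fin N, M / δ ^ (6 * J + 6) :=
          (Finset.abs_sum_le_sum_abs _ _).trans (Finset.sum_le_sum fun k _ => hterm k)
      _ = (δ * (N * M)) / δ ^ (6 * J + 7) := by
          simp only [Finset.sum_const, Finset.card_univ, Fintype.card_fin, nsmul_eq_mul]
          rw [show 6 * J + 7 = (6 * J + 6) + 1 from rfl, pow_succ]
          field_simp
          ring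
      _ ≤ 1 / δ ^ (6 * J + 7) := by gcongr; exact hS.nm
  have hGdiff : ∀ x ∈ Icc xm xM, |G l x - G l x1| ≤ δ ^ 5 := by
    intro x hx
    have h4 := (convex_Icc xm xM).norm_image_sub_le_of_norm_hasDerivWithin_le (hGd l) hGb hx1 hx
    rw [Real.norm_eq_abs, Real.norm_eq_abs] at h4
    refine h4.trans ?_
    have h5 : |x - x1| ≤ δ ^ (6 * J + 12) := by
      refine abs_le.2 ⟨?_, ?_⟩ <;> linarith [hx.1, hx.2, hx1.1, hx1.2]
    calc _ ≤ 1 / δ ^ (6 * J + 7) * δ ^ (6 * J + 12) :=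
          mul_le_mul_of_nonneg_left h5 (by positivity)
      _ = δ ^ 5 := by
          rw [show 6 * J + 12 = (6 * J + 7) + 5 from rfl, pow_add δ (6 * J + 7) 5]
          field_simp
  have h45 : δ ^ 5 * 4 ≤ δ ^ 4 := by
    have := mul_le_mul_of_nonneg_right hS.four (show 0 ≤ δ ^ 4 by positivity)
    nlinarith
  have h5p : 0 < δ ^ 5 := by positivity
  have hsign : (∀ x ∈ Icc xm xM, δ ^ 5 ≤ G l x) ∨ (∀ x ∈ Icc xm xM, G l x ≤ -δ ^ 5) := by
    rcases le_abs.1 hG1 with h | h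
    · left; intro x hx
      have := (abs_le.1 (hGdiff x hx)).1
      linarith
    · right; intro x hx
      have := (abs_le.1 (hGdiff x hx)).2
      linarith
  have hfin := sublevel_one_dim_abs l (Icc xm xM) (convex_Icc _ _) G (δ ^ 5) ρ h5p hρ hGd hsign
  refine (measure_mono ?_).trans (hfin.trans ?_)
  · rintro x ⟨hx, y, hy, hφe, hsum⟩
    refine ⟨hx, ?_⟩
    have hyc : y = c x := by
      refine fiber_inj hB hS hqK hD (x := x) (hball ⟨hx, ?_⟩) (hball (hcZ x hx)) ?_
      · simpa [Real.dist_eq] using hy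
      · rw [hφe, hcφ x hx]
    have h4 : G 0 x = ∑ k, a k (x, y) * w k := by
      simp [hG, hyc, Pj]
    rw [h4]
    refine hsum.trans_le (hE.trans ?_)
    exact mul_le_mul_of_nonneg_left (pow_le_pow_of_le_one hρ.le hρ1 hlJ) h5p.le
  · apply ENNReal.ofReal_le_ofReal
    refine mul_le_mul_of_nonneg_right ?_ hρ.le
    have : (2 : ℝ) ^ (l + 1) ≤ 2 ^ (J + 1) := pow_le_pow_right₀ (by norm_num) (by omega)
    linarith

end


theorem det_fst_prod (f : ℝ × ℝ →L[ℝ] ℝ) :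
    ((ContinuousLinearMap.fst ℝ ℝ ℝ).prod f).det = f (0, 1) := by
  rw [ContinuousLinearMap.det, ← LinearMap.det_toMatrix (Module.Basis.finTwoProd ℝ),
    Matrix.det_fin_two]
  simp [LinearMap.toMatrix_apply]

section
variable {N : ℕ} {φ : ℝ × ℝ → ℝ} {a : Fin N → ℝ × ℝ → ℝ} {j : Fin N → ℕ} {J : ℕ} {M δ : ℝ}
  {V K' : Set (ℝ × ℝ)}

theorem box_est (hB : Bd φ a j J M V K') (hS : Sm N J M δ) {S : Set (ℝ × ℝ)}
    (hSm : MeasurableSet S) (hSK : ∀ q ∈ S, Metric.closedBall q δ ⊆ K')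
    (hSD : ∀ q ∈ S, δ ≤ |dirD (0, 1) φ q * (PMat φ a j q).det|)
    (hdiam : ∀ q ∈ S, ∀ q' ∈ S, dist q q' ≤ δ ^ 4) {b : ℝ≥0∞}
    (hfib : ∀ t, volume {x | ∃ y, (x, y) ∈ S ∧ φ (x, y) = t} ≤ b) :
    ENNReal.ofReal (δ ^ 3) * volume S ≤ b * ENNReal.ofReal (2 * M) := by
  have h3 := hS.pos
  have hSV : ∀ q ∈ S, q ∈ V := fun q hq => hB.hKV (hSK q hq (Metric.mem_closedBall_self h3.le))
  set Φ : ℝ × ℝ → ℝ × ℝ := fun q => (q.1, φ q) with hΦ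
  have hder : ∀ q ∈ S, HasFDerivWithinAt Φ
      ((ContinuousLinearMap.fst ℝ ℝ ℝ).prod (fderiv ℝ φ q)) S q := fun q hq =>
    ((ContinuousLinearMap.fst ℝ ℝ ℝ).hasFDerivAt.prodMk
      (hB.hφ q (hSV q hq)).differentiableAt.hasFDerivAt).hasFDerivWithinAt
  have hinj : InjOn Φ S := by
    rintro ⟨x, y⟩ hq ⟨x', y'⟩ hq' he
    simp only [hΦ, Prod.mk.injEq] at he
    obtain ⟨rfl, he⟩ := he
    have := fiber_inj hB hS (hSK _ hq) (hSD _ hq) (x := x) (y := y) (y' := y')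
      (Metric.mem_closedBall_self (by positivity)) (hdiam _ hq' _ hq) he
    rw [this]
  have hvol := lintegral_abs_det_fderiv_eq_addHaar_image volume hSm hder hinj
  have hmeas : MeasurableSet (Φ '' S) := measurable_image_of_fderivWithin hSm hder hinj
  have hlow : ENNReal.ofReal (δ ^ 3) * volume S ≤ volume (Φ '' S) := by
    rw [← hvol, ← setLIntegral_const]
    refine setLIntegral_mono' hSm fun q hq => ENNReal.ofReal_le_ofReal ?_
    rw [det_fst_prod]
    exact (lower_near hB hS (hSK q hq) (hSD q hq) (Metric.mem_closedBall_self (by positivity))).2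
  refine hlow.trans ?_
  rw [Measure.volume_eq_prod, Measure.prod_apply_symm hmeas]
  calc ∫⁻ t, volume ((fun x => (x, t)) ⁻¹' (Φ '' S))
      ≤ ∫⁻ t, (Icc (-M) M).indicator (fun _ => b) t := by
        refine lintegral_mono fun t => ?_
        by_cases ht : t ∈ Icc (-M) M
        · rw [indicator_of_mem ht]
          refine (measure_mono ?_).trans (hfib t)
          rintro x ⟨⟨x', y⟩, hq, he⟩
          simp only [hΦ, Prod.mk.injEq] at he
          obtain ⟨rfl, he⟩ := he
          exact ⟨y, hq, he⟩
        · rw [indicator_of_notMem ht]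
          refine le_of_eq ?_
          have : (fun x => (x, t)) ⁻¹' (Φ '' S) = ∅ := by
            rw [eq_empty_iff_forall_notMem]
            rintro x ⟨⟨x', y⟩, hq, he⟩
            simp only [hΦ, Prod.mk.injEq] at he
            apply ht
            rw [← he.2]
            exact abs_le.1 (hB.bphi _ (hSK _ hq (Metric.mem_closedBall_self h3.le)))
          rw [this, measure_empty]
    _ = b * ENNReal.ofReal (2 * M) := by
        rw [lintegral_indicator measurableSet_Icc, setLIntegral_const, Real.volume_Icc]
        congr 2; ring

end


section
variable {N : ℕ} {φ : ℝ × ℝ → ℝ} {a : Fin N → ℝ × ℝ → ℝ} {j : Fin N → ℕ} {J : ℕ} {M δ : ℝ}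
  {V K' : Set (ℝ × ℝ)}

theorem eta_small (hS : Sm N J M δ) : δ ^ (6 * J + 12) ≤ δ ^ 4 / 2 := by
  have h3 := hS.pos
  have h31 : δ ≤ 1 := by linarith [hS.four]
  have h1 : δ ^ (6 * J + 12) ≤ δ ^ 5 := pow_le_pow_of_le_one h3.le h31 (by omega)
  have h2 : δ ^ 5 * 4 = (δ * 4) * δ ^ 4 := by ring
  have h4 : (δ * 4) * δ ^ 4 ≤ 1 * δ ^ 4 := mul_le_mul_of_nonneg_right hS.four (by positivity)
  have : 0 < δ ^ 5 := by positivity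
  linarith

theorem cell_est (hB : Bd φ a j J M V K') (hS : Sm N J M δ) {S : Set (ℝ × ℝ)}
    (hSm : MeasurableSet S) (hSK : ∀ q ∈ S, Metric.closedBall q δ ⊆ K')
    (hSD : ∀ q ∈ S, δ ≤ |dirD (0, 1) φ q * (PMat φ a j q).det|)
    {f : Fin N → ℝ → ℝ} {ρ : ℝ} (hρ : 0 < ρ) (hρ1 : ρ ≤ 1)
    (hSf : ∀ q ∈ S, |∑ k, a k q * f k (φ q)| < δ ^ 5 * ρ ^ J)
    (hSn : ∀ q ∈ S, 1 ≤ Real.sqrt (∑ k, (f k (φ q)) ^ 2))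
    {u v : ℝ} (hcell : ∀ q ∈ S, q.1 ∈ Icc u (u + δ ^ (6 * J + 12)) ∧
      q.2 ∈ Icc v (v + δ ^ (6 * J + 12))) :
    volume S ≤ ENNReal.ofReal (2 ^ (J + 1) * ρ * (2 * M) / δ ^ 3) := by
  have h3 := hS.pos
  have hη := eta_small hS
  have h4 : 0 < δ ^ 4 := by positivity
  have hM := hB.hM
  have hdiam : ∀ q ∈ S, ∀ q' ∈ S, dist q q' ≤ δ ^ 4 := by
    intro q hq q' hq'
    have h1 := hcell q hq
    have h2 := hcell q' hq'
    rw [Prod.dist_eq, Real.dist_eq, Real.dist_eq]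
    refine max_le (abs_le.2 ⟨?_, ?_⟩) (abs_le.2 ⟨?_, ?_⟩) <;>
      linarith [h1.1.1, h1.1.2, h1.2.1, h1.2.2, h2.1.1, h2.1.2, h2.2.1, h2.2.2]
  have hfib : ∀ t, volume {x | ∃ y, (x, y) ∈ S ∧ φ (x, y) = t} ≤
      ENNReal.ofReal (2 ^ (J + 1) * ρ) := by
    intro t
    rcases eq_empty_or_nonempty {x | ∃ y, (x, y) ∈ S ∧ φ (x, y) = t} with he | ⟨x1, y1, hq1, ht⟩
    · rw [he, measure_empty]; exact zero_le
    have hn := hSn _ hq1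
    rw [ht] at hn
    set s := Real.sqrt (∑ k, (f k t) ^ 2) with hs
    have hs0 : 0 < s := by linarith
    have hs2 : s ^ 2 = ∑ k, (f k t) ^ 2 := Real.sq_sqrt (Finset.sum_nonneg fun k _ => sq_nonneg _)
    have hw : ∑ k, (f k t / s) ^ 2 = 1 := by
      simp_rw [div_pow]
      rw [← Finset.sum_div, ← hs2]
      field_simp
    have hfe := fiber_est hB hS (hSK _ hq1) (hSD _ hq1) (hcell _ hq1).1
      (by simp) hw hρ hρ1 le_rfl
    refine (measure_mono ?_).trans (hfe.trans ?_)
    · rintro x ⟨y, hxy, hxt⟩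
      refine ⟨(hcell _ hxy).1, y, ?_, by rw [hxt, ht], ?_⟩
      · have h1 := (hcell _ hxy).2
        have h2 := (hcell _ hq1).2
        simp only at h1 h2
        refine abs_le.2 ⟨?_, ?_⟩ <;> linarith [h1.1, h1.2, h2.1, h2.2]
      · have h1 := hSf _ hxy
        rw [hxt] at h1
        have h2 : ∑ k, a k (x, y) * (f k t / s) = (∑ k, a k (x, y) * f k t) / s := by
          rw [Finset.sum_div]
          exact Finset.sum_congr rfl fun k _ => by ring
        rw [h2, abs_div, abs_of_pos hs0]
        exact (div_le_self (abs_nonneg _) hn).trans_lt h1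
    · apply ENNReal.ofReal_le_ofReal
      nlinarith
  have hbox := box_est hB hS hSm hSK hSD hdiam hfib
  have hd : 0 < δ ^ 3 := by positivity
  rw [← ENNReal.ofReal_mul (by positivity), mul_comm] at hbox
  rw [ENNReal.ofReal_div_of_pos hd]
  exact (ENNReal.le_div_iff_mul_le (Or.inl (by simpa using hd)) (Or.inl ENNReal.ofReal_ne_top)).2 hbox

theorem grid_cover {η R x : ℝ} (hη : 0 < η) (hx : |x| ≤ R) :
    ∃ i ∈ Finset.Icc (-(⌈R / η⌉₊ : ℤ)) (⌈R / η⌉₊ : ℤ), x ∈ Icc (i * η) (i * η + η) := by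
  have h1 := Int.floor_le (x / η)
  have h2 := Int.lt_floor_add_one (x / η)
  have hxη : x = x / η * η := by field_simp
  have hx' := abs_le.1 hx
  have hc := Nat.le_ceil (R / η)
  refine ⟨⌊x / η⌋, Finset.mem_Icc.2 ⟨?_, ?_⟩, ?_, ?_⟩
  · rw [Int.le_floor]
    push_cast
    have : -(R / η) ≤ x / η := by rw [← neg_div]; gcongr; exact hx'.1
    linarith
  · have : x / η ≤ R / η := by gcongr; exact hx'.2
    have h3 : ((⌊x / η⌋ : ℤ) : ℝ) ≤ ((⌈R / η⌉₊ : ℤ) : ℝ) := by push_cast; linarith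
    exact_mod_cast h3
  · nlinarith
  · nlinarith

theorem grid_est (hB : Bd φ a j J M V K') (hS : Sm N J M δ) {S : Set (ℝ × ℝ)}
    (hSm : MeasurableSet S) (hSK : ∀ q ∈ S, Metric.closedBall q δ ⊆ K')
    (hSD : ∀ q ∈ S, δ ≤ |dirD (0, 1) φ q * (PMat φ a j q).det|)
    {f : Fin N → ℝ → ℝ} {R : ℝ} (hR1 : 1 ≤ R)
    (hSf : ∀ q ∈ S, |∑ k, a k q * f k (φ q)| < δ ^ 5 * (δ ^ (12 * J + 28)) ^ J)
    (hSn : ∀ q ∈ S, 1 ≤ Real.sqrt (∑ k, (f k (φ q)) ^ 2))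
    (hSR : ∀ q ∈ S, |q.1| ≤ R ∧ |q.2| ≤ R) :
    volume S ≤ ENNReal.ofReal ((5 * R) ^ 2 * (2 ^ (J + 1) * (2 * M)) * δ) := by
  have h3 := hS.pos
  have h31 : δ ≤ 1 := by linarith [hS.four]
  have hM := hB.hM
  set η := δ ^ (6 * J + 12) with hη
  have hη0 : 0 < η := by positivity
  have hη1 : η ≤ 1 := pow_le_one₀ h3.le h31
  set ρ := δ ^ (12 * J + 28) with hρ
  have hρ0 : 0 < ρ := by positivity
  have hρ1 : ρ ≤ 1 := pow_le_one₀ h3.le h31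
  set m := ⌈R / η⌉₊ with hm
  set T := (Finset.Icc (-(m : ℤ)) (m : ℤ)) with hT
  set cell : ℤ × ℤ → Set (ℝ × ℝ) := fun i =>
    S ∩ (Icc (i.1 * η) (i.1 * η + η) ×ˢ Icc (i.2 * η) (i.2 * η + η)) with hcell
  have hcov : S ⊆ ⋃ i ∈ T ×ˢ T, cell i := by
    intro q hq
    obtain ⟨i, hi, hi'⟩ := grid_cover hη0 (hSR q hq).1
    obtain ⟨k, hk, hk'⟩ := grid_cover hη0 (hSR q hq).2
    simp only [mem_iUnion]
    exact ⟨(i, k), Finset.mk_mem_product hi hk, hq, hi', hk'⟩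
  have hc : ∀ i, volume (cell i) ≤ ENNReal.ofReal (2 ^ (J + 1) * ρ * (2 * M) / δ ^ 3) := by
    intro i
    refine cell_est hB hS (hSm.inter (measurableSet_Icc.prod measurableSet_Icc))
      (fun q hq => hSK q hq.1) (fun q hq => hSD q hq.1) hρ0 hρ1 (fun q hq => hSf q hq.1)
      (fun q hq => hSn q hq.1) (fun q hq => ⟨hq.2.1, hq.2.2⟩)
  have hcard : ((T ×ˢ T).card : ℝ) ≤ (5 * R / η) ^ 2 := by
    rw [Finset.card_product, hT, Int.card_Icc]
    have h1 : ((m : ℤ) + 1 - -(m : ℤ)).toNat = 2 * m + 1 := by omega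
    rw [h1]
    push_cast
    have h2 : (m : ℝ) < R / η + 1 := Nat.ceil_lt_add_one (by positivity)
    have h4 : 1 ≤ R / η := by rw [le_div_iff₀ hη0]; linarith
    have h5 : (2 * (m : ℝ) + 1) ≤ 5 * R / η := by
      rw [mul_div_assoc]; linarith
    rw [sq]
    exact mul_le_mul h5 h5 (by positivity) (by positivity)
  calc volume S ≤ volume (⋃ i ∈ T ×ˢ T, cell i) := measure_mono hcov
    _ ≤ ∑ i ∈ T ×ˢ T, volume (cell i) := measure_biUnion_finset_le _ _
    _ ≤ ∑ i ∈ T ×ˢ T, ENNReal.ofReal (2 ^ (J + 1) * ρ * (2 * M) / δ ^ 3) :=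
        Finset.sum_le_sum fun i _ => hc i
    _ = ENNReal.ofReal ((T ×ˢ T).card * (2 ^ (J + 1) * ρ * (2 * M) / δ ^ 3)) := by
        rw [Finset.sum_const, nsmul_eq_mul, ENNReal.ofReal_mul (by positivity),
          ENNReal.ofReal_natCast]
    _ ≤ ENNReal.ofReal ((5 * R / η) ^ 2 * (2 ^ (J + 1) * ρ * (2 * M) / δ ^ 3)) :=
        ENNReal.ofReal_le_ofReal (mul_le_mul_of_nonneg_right hcard (by positivity))
    _ = _ := by
        congr 1
        have h6 : ρ = η ^ 2 * δ ^ 3 * δ := by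
          rw [hρ, hη]; ring
        rw [h6]
        field_simp

end


theorem PMat_det_analytic {N : ℕ} {φ : ℝ × ℝ → ℝ} {a : Fin N → ℝ × ℝ → ℝ} {j : Fin N → ℕ}
    {V : Set (ℝ × ℝ)} (hφ : AnalyticOnNhd ℝ φ V) (ha : ∀ k, AnalyticOnNhd ℝ (a k) V) :
    AnalyticOnNhd ℝ (fun q => (PMat φ a j q).det) V := by
  intro q hq
  simp only [Matrix.det_apply', PMat, Matrix.of_apply]
  refine Finset.analyticAt_fun_sum _ fun s _ => analyticAt_const.mul ?_
  exact Finset.analyticAt_fun_prod _ fun i _ => Pj_analytic hφ (ha i) _ q hq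

theorem PMat_continuousOn {N : ℕ} {φ : ℝ × ℝ → ℝ} {a : Fin N → ℝ × ℝ → ℝ} {j : Fin N → ℕ}
    {V : Set (ℝ × ℝ)} (hφ : AnalyticOnNhd ℝ φ V) (ha : ∀ k, AnalyticOnNhd ℝ (a k) V) :
    ContinuousOn (PMat φ a j) V := by
  refine continuousOn_pi.2 fun i => continuousOn_pi.2 fun k => ?_
  exact (Pj_analytic hφ (ha k) (j i)).continuousOn

theorem bound_family {ι : Type*} [Fintype ι] {K' : Set (ℝ × ℝ)} (hK' : IsCompact K')
    (g : ι → ℝ × ℝ → ℝ) (hg : ∀ i, ContinuousOn (g i) K') :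
    ∃ M : ℝ, 0 ≤ M ∧ ∀ i, ∀ p ∈ K', |g i p| ≤ M := by
  choose B hBd using fun i => hK'.exists_bound_of_continuousOn (hg i)
  refine ⟨∑ i, |B i|, Finset.sum_nonneg fun i _ => abs_nonneg _, fun i p hp => ?_⟩
  exact (hBd i p hp).trans ((le_abs_self _).trans
    (Finset.single_le_sum (f := fun i => |B i|) (fun i _ => abs_nonneg _) (Finset.mem_univ i)))

theorem exists_Bd {N : ℕ} {φ : ℝ × ℝ → ℝ} {a : Fin N → ℝ × ℝ → ℝ} (j : Fin N → ℕ)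
    {V K' : Set (ℝ × ℝ)} (hφ : AnalyticOnNhd ℝ φ V) (ha : ∀ k, AnalyticOnNhd ℝ (a k) V)
    (hK' : IsCompact K') (hKV : K' ⊆ V) :
    ∃ J M, Bd φ a j J M V K' := by
  set J := ∑ i, j i with hJ
  have hy := dirD_analytic (0, 1) hφ
  obtain ⟨M1, hM1, h1⟩ := bound_family hK' (fun _ : Unit => dirD (1, 0) φ)
    (fun _ => (dirD_analytic (1, 0) hφ).continuousOn.mono hKV)
  obtain ⟨M2, hM2, h2⟩ := bound_family hK' (fun _ : Unit => dirD (0, 1) φ)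
    (fun _ => hy.continuousOn.mono hKV)
  obtain ⟨M3, hM3, h3⟩ := bound_family hK' (fun _ : Unit => φ) (fun _ => hφ.continuousOn.mono hKV)
  obtain ⟨M4, hM4, h4⟩ := bound_family hK' (fun _ : Unit => fun p => ‖fderiv ℝ (dirD (0, 1) φ) p‖)
    (fun _ => hy.fderiv.continuousOn.norm.mono hKV)
  obtain ⟨M5, hM5, h5⟩ := bound_family hK' (fun i : Fin N × Fin (J + 2) => Pj φ (a i.1) i.2)
    (fun i => (Pj_analytic hφ (ha i.1) i.2).continuousOn.mono hKV)
  obtain ⟨M6, hM6, h6⟩ := bound_family hK' (fun _ : Unit => fun p => (PMat φ a j p).det)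
    (fun _ => (PMat_det_analytic hφ ha).continuousOn.mono hKV)
  obtain ⟨M7, hM7, h7⟩ := bound_family hK'
    (fun i : Fin N × Fin N => fun p => (PMat φ a j p).adjugate i.1 i.2)
    (fun i => by
      have hc : Continuous (fun A : Matrix (Fin N) (Fin N) ℝ => A.adjugate i.1 i.2) :=
        (continuous_id.matrix_adjugate).matrix_elem i.1 i.2
      exact hc.comp_continuousOn ((PMat_continuousOn hφ ha).mono hKV))
  refine ⟨J, 1 + M1 + M2 + M3 + M4 + M5 + M6 + M7, hφ, ha, hKV, by linarith, fun i => ?_,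
    fun p hp => ?_, fun p hp => ?_, fun p hp => ?_, fun p hp => ?_, fun k l hl p hp => ?_,
    fun p hp => ?_, fun p hp i k => ?_⟩
  · exact Finset.single_le_sum (f := j) (fun i _ => Nat.zero_le _) (Finset.mem_univ i)
  · linarith [h1 () p hp]
  · linarith [h2 () p hp]
  · linarith [h3 () p hp]
  · have := h4 () p hp
    rw [abs_of_nonneg (norm_nonneg _)] at this
    linarith
  · linarith [h5 (k, ⟨l, by omega⟩) p hp]
  · linarith [h6 () p hp]
  · linarith [h7 (i, k) p hp]

theorem exists_Sm (N J : ℕ) {M θ : ℝ} (hM : 1 ≤ M) (hθ : 0 < θ) :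
    ∃ δ0 : ℝ, 0 < δ0 ∧ δ0 ≤ 1 ∧ ∀ δ, 0 < δ → δ ≤ δ0 → Sm N J M δ ∧ δ ≤ θ := by
  set Q : ℝ := 4 + M + N * M + 2 * N * N * M + M ^ (2 * J) + 1 / θ with hQ
  have hM0 : 0 ≤ M := by linarith
  have a1 : 0 ≤ N * M := by positivity
  have a2 : 0 ≤ 2 * N * N * M := by positivity
  have a3 : 0 ≤ M ^ (2 * J) := by positivity
  have a4 : 0 < 1 / θ := by positivity
  have hQ0 : 4 ≤ Q := by linarith
  have hQp : 0 < Q := by linarith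
  refine ⟨1 / Q, by positivity, by rw [div_le_one hQp]; linarith, fun δ hδ hle => ?_⟩
  have hδQ : δ * Q ≤ 1 := by rwa [le_div_iff₀ hQp] at hle
  have key : ∀ b, b ≤ Q → δ * b ≤ 1 := fun b hb => (mul_le_mul_of_nonneg_left hb hδ.le).trans hδQ
  refine ⟨⟨hδ, key _ (by linarith), key _ (by linarith), key _ (by linarith), key _ (by linarith),
    key _ (by linarith)⟩, ?_⟩
  have := key (1 / θ) (by linarith)
  rwa [mul_one_div, div_le_one hθ] at this

theorem sublevel_measurable {N : ℕ} {φ D : ℝ × ℝ → ℝ} {a : Fin N → ℝ × ℝ → ℝ}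
    {K : Set (ℝ × ℝ)} (hK : MeasurableSet K) (hφ : ContinuousOn φ K)
    (ha : ∀ k, ContinuousOn (a k) K) (hD : ContinuousOn D K) {f : Fin N → ℝ → ℝ}
    (hf : ∀ k, Measurable (f k)) (ε δ : ℝ) :
    MeasurableSet {x ∈ K | (|∑ k, a k x * f k (φ x)| < ε ∧
      1 ≤ Real.sqrt (∑ k, (f k (φ x)) ^ 2)) ∧ δ ≤ |D x|} := by
  have hφ' : Measurable (fun x : K => φ x) := (continuousOn_iff_continuous_domRestrict.1 hφ).measurable
  have ha' : ∀ k, Measurable (fun x : K => a k x) := fun k =>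
    (continuousOn_iff_continuous_domRestrict.1 (ha k)).measurable
  have hD' : Measurable (fun x : K => D x) := (continuousOn_iff_continuous_domRestrict.1 hD).measurable
  have hf' : ∀ k, Measurable (fun x : K => f k (φ x)) := fun k => (hf k).comp hφ'
  have h1 : MeasurableSet {x : K | (|∑ k, a k x * f k (φ x)| < ε ∧
      1 ≤ Real.sqrt (∑ k, (f k (φ x)) ^ 2)) ∧ δ ≤ |D x|} := by
    have m1 : MeasurableSet {x : K | |∑ k, a k x * f k (φ x)| < ε} :=
      measurableSet_lt (Finset.measurable_fun_sum _ fun k _ => (ha' k).mul (hf' k)).abs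
        measurable_const
    have m2 : MeasurableSet {x : K | 1 ≤ Real.sqrt (∑ k, (f k (φ x)) ^ 2)} :=
      measurableSet_le measurable_const
        (Finset.measurable_fun_sum _ fun k _ => (hf' k).pow_const 2).sqrt
    have m3 : MeasurableSet {x : K | δ ≤ |D x|} := measurableSet_le measurable_const hD'.abs
    exact (m1.inter m2).inter m3
  have h2 := hK.subtype_image h1
  convert h2 using 1
  ext x
  constructor
  · rintro ⟨hx, h⟩; exact ⟨⟨x, hx⟩, h, rfl⟩
  · rintro ⟨⟨x', hx⟩, h, rfl⟩; exact ⟨hx, h⟩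

theorem core {V K K' : Set (ℝ × ℝ)} (hV : IsOpen V) (hVc : Convex ℝ V) (hK : IsCompact K)
    (hK' : IsCompact K') (hKV : K' ⊆ V) {θ : ℝ} (hθ : 0 < θ)
    (hKK : ∀ q ∈ K, Metric.closedBall q θ ⊆ K') {N : ℕ}
    {a : Fin N → ℝ × ℝ → ℝ} (ha : ∀ k, AnalyticOnNhd ℝ (a k) V)
    {φ : ℝ × ℝ → ℝ} (hφ : AnalyticOnNhd ℝ φ V) {p : ℝ × ℝ} (hp : p ∈ V)
    (hpy : dirD (0, 1) φ p ≠ 0)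
    (hMain : ∀ U : Set (ℝ × ℝ), U ⊆ V → IsOpen U → U.Nonempty →
      ∀ f : Fin N → ℝ → ℝ, (∀ k, AnalyticOnNhd ℝ (f k) (φ '' U)) →
      (∀ x ∈ U, ∑ k, a k x * f k (φ x) = 0) →
      ∀ k, ∀ y ∈ φ '' U, f k y = 0) :
    ∃ τ C : ℝ, 0 < τ ∧ 0 < C ∧
      ∀ ε : ℝ, 0 < ε → ∀ f : Fin N → ℝ → ℝ, (∀ k, Measurable (f k)) →
        volume {x ∈ K | |∑ k, a k x * f k (φ x)| < ε ∧
            1 ≤ Real.sqrt (∑ k, (f k (φ x)) ^ 2)} ≤ ENNReal.ofReal (C * ε ^ τ) := by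
  obtain ⟨j, q, hq, hdet⟩ := exists_det_ne_zero hV ha hφ hp hpy hMain
  have hKV0 : K ⊆ V := fun q hq => hKV (hKK q hq (Metric.mem_closedBall_self hθ.le))
  set D : ℝ × ℝ → ℝ := fun q => dirD (0, 1) φ q * (PMat φ a j q).det with hD
  have hya := dirD_analytic (0, 1) hφ
  have hda : AnalyticOnNhd ℝ (fun q => (PMat φ a j q).det) V := PMat_det_analytic hφ ha
  have hDa : AnalyticOnNhd ℝ D V := hya.mul hda
  have hDne : ∃ q' ∈ V, D q' ≠ 0 := by
    by_contra! hcon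
    have hev : ∀ᶠ z in nhds p, (PMat φ a j z).det = 0 := by
      filter_upwards [(hya p hp).continuousAt.eventually_ne hpy, hV.mem_nhds hp] with z hz hzV
      exact (mul_eq_zero.1 (hcon z hzV)).resolve_left hz
    exact hdet (hda.eqOn_zero_of_preconnected_of_eventuallyEq_zero hVc.isPreconnected hp hev hq)
  obtain ⟨q', hq', hDq'⟩ := hDne
  obtain ⟨n, hn, C0, hC0, hsub⟩ := sublevel_two_dim hV hVc hDa hq' hDq' hK hKV0
  obtain ⟨J, M, hB⟩ := exists_Bd j hφ ha hK' hKV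
  have hM := hB.hM
  obtain ⟨σ0, hσ0, hσ01, hSm⟩ := exists_Sm N J hM hθ
  obtain ⟨R0, hR0⟩ := hK.isBounded.exists_norm_le
  set R := max R0 1 with hR
  set L := 5 + (12 * J + 28) * J with hL
  set C1 : ℝ := (5 * R) ^ 2 * (2 ^ (J + 1) * (2 * M)) with hC1
  have hC1p : 0 ≤ C1 := by positivity
  have hvK : volume K ≠ ⊤ := hK.measure_lt_top.ne
  set vK := (volume K).toReal with hvKdef
  have hvK0 : 0 ≤ vK := ENNReal.toReal_nonneg
  have hnL : 0 < n * L := Nat.mul_pos (by omega) (by omega)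
  have hnLR : (0 : ℝ) < ((n * L : ℕ) : ℝ) := by exact_mod_cast hnL
  refine ⟨1 / ((n * L : ℕ) : ℝ), C0 + C1 + vK / σ0 + 1, by positivity, by positivity, ?_⟩
  intro ε hε f hf
  set σ := ε ^ (1 / ((n * L : ℕ) : ℝ)) with hσ
  have hσp : 0 < σ := Real.rpow_pos_of_pos hε _
  have hσε : σ ^ (n * L) = ε := by
    rw [hσ, ← Real.rpow_natCast, ← Real.rpow_mul hε.le, one_div_mul_cancel hnLR.ne', Real.rpow_one]
  by_cases hcase : σ ≤ σ0
  · set δ := σ ^ n with hδ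
    have hδp : 0 < δ := by positivity
    have hσ1 : σ ≤ 1 := hcase.trans hσ01
    have hδσ : δ ≤ σ := pow_le_of_le_one hσp.le hσ1 (by omega)
    obtain ⟨hS, hδθ⟩ := hSm δ hδp (hδσ.trans hcase)
    have hεδ : ε = δ ^ 5 * (δ ^ (12 * J + 28)) ^ J := by
      rw [← hσε, pow_mul, ← hδ, hL, pow_add, pow_mul]
    set S := {x ∈ K | (|∑ k, a k x * f k (φ x)| < ε ∧
      1 ≤ Real.sqrt (∑ k, (f k (φ x)) ^ 2)) ∧ δ ≤ |D x|} with hSdef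
    have hSmeas : MeasurableSet S := sublevel_measurable hK.measurableSet
      (hφ.continuousOn.mono hKV0) (fun k => (ha k).continuousOn.mono hKV0)
      (hDa.continuousOn.mono hKV0) hf ε δ
    have hgrid := grid_est hB hS (S := S) hSmeas
      (fun q hq => (Metric.closedBall_subset_closedBall hδθ).trans (hKK q hq.1))
      (fun q hq => hq.2.2) (f := f) (R := R) (le_max_right _ _)
      (fun q hq => hεδ ▸ hq.2.1.1) (fun q hq => hq.2.1.2)
      (fun q hq => by
        have h1 := (hR0 q hq.1).trans (le_max_left R0 1)
        rw [Prod.norm_def, max_le_iff] at h1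
        exact h1)
    have hsmall := hsub σ hσp hσ1
    have hcov : {x ∈ K | |∑ k, a k x * f k (φ x)| < ε ∧
        1 ≤ Real.sqrt (∑ k, (f k (φ x)) ^ 2)} ⊆ S ∪ {x ∈ K | |D x| < σ ^ n} := by
      rintro x ⟨hx, h⟩
      by_cases hDx : δ ≤ |D x|
      · exact Or.inl ⟨hx, h, hDx⟩
      · exact Or.inr ⟨hx, not_le.1 hDx⟩
    calc _ ≤ volume S + volume {x ∈ K | |D x| < σ ^ n} :=
          (measure_mono hcov).trans (measure_union_le _ _)
      _ ≤ ENNReal.ofReal (C1 * δ) + ENNReal.ofReal (C0 * σ) := add_le_add hgrid hsmall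
      _ = ENNReal.ofReal (C1 * δ + C0 * σ) :=
          (ENNReal.ofReal_add (by positivity) (by positivity)).symm
      _ ≤ _ := by
          apply ENNReal.ofReal_le_ofReal
          have h1 : C1 * δ ≤ C1 * σ := mul_le_mul_of_nonneg_left hδσ hC1p
          have h2 : 0 ≤ (vK / σ0 + 1) * σ := by positivity
          linarith
  · push Not at hcase
    calc _ ≤ volume K := measure_mono fun x hx => hx.1
      _ = ENNReal.ofReal vK := (ENNReal.ofReal_toReal hvK).symm
      _ ≤ _ := by
          apply ENNReal.ofReal_le_ofReal
          have h1 : vK = vK / σ0 * σ0 := by field_simp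
          have h2 : vK / σ0 * σ0 ≤ vK / σ0 * σ := mul_le_mul_of_nonneg_left hcase.le (by positivity)
          have h3 : 0 ≤ (C0 + C1 + 1) * σ := by positivity
          linarith


/-- Proposition 14.2 (the case `n = 1` of Theorem 14.1): sublevel set inequality for
sums `∑ₖ aₖ·(fₖ∘φ)` with a single real analytic map `φ`. -/
theorem one_map_sublevel_inequality
    (x₀ : EuclideanSpace ℝ (Fin 2)) (r : ℝ) (hr : 0 < r)
    (Bt : Set (EuclideanSpace ℝ (Fin 2))) (hBtOpen : IsOpen Bt)
    (hBBt : Metric.closedBall x₀ r ⊆ Bt)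
    (N : ℕ)
    (a : Fin N → EuclideanSpace ℝ (Fin 2) → ℝ)
    (ha : ∀ k, AnalyticOnNhd ℝ (a k) Bt)
    (φ : EuclideanSpace ℝ (Fin 2) → ℝ) (hφ : AnalyticOnNhd ℝ φ Bt)
    (hφNonconst : ∃ x ∈ Metric.closedBall x₀ r, ∃ y ∈ Metric.closedBall x₀ r, φ x ≠ φ y)
    (hMain : ∀ U : Set (EuclideanSpace ℝ (Fin 2)), U ⊆ Bt → IsOpen U → U.Nonempty →
      ∀ f : Fin N → ℝ → ℝ, (∀ k, AnalyticOnNhd ℝ (f k) (φ '' U)) →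
      (∀ x ∈ U, ∑ k, a k x * f k (φ x) = 0) →
      ∀ k, ∀ y ∈ φ '' U, f k y = 0) :
    ∃ τ C : ℝ, 0 < τ ∧ 0 < C ∧
      ∀ ε : ℝ, 0 < ε → ∀ f : Fin N → ℝ → ℝ, (∀ k, Measurable (f k)) →
        volume {x ∈ Metric.closedBall x₀ r |
            |∑ k, a k x * f k (φ x)| < ε ∧
            1 ≤ Real.sqrt (∑ k, (f k (φ x)) ^ 2)} ≤
          ENNReal.ofReal (C * ε ^ τ) := by
  obtain ⟨d, hd, hdB⟩ := (isCompact_closedBall x₀ r).exists_cthickening_subset_open hBtOpen hBBt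
  rw [cthickening_closedBall hd.le hr.le] at hdB
  obtain ⟨x, hx, y, hy, hxy⟩ := hφNonconst
  have hne : y - x ≠ 0 := by
    intro h
    rw [sub_eq_zero] at h
    exact hxy (by rw [h])
  obtain ⟨Λ, hΛ⟩ := exists_equiv_dir (F := EuclideanSpace ℝ (Fin 2)) (by simp) (y - x) hne
  obtain ⟨C0, hC0, hcomp⟩ := haar_compare (volume : Measure (EuclideanSpace ℝ (Fin 2))) Λ
  set V : Set (ℝ × ℝ) := Λ ⁻¹' Metric.ball x₀ (d + r) with hVdef
  have hVB : ∀ q ∈ V, Λ q ∈ Bt := fun q hq => hdB (Metric.ball_subset_closedBall hq)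
  have hV : IsOpen V := Metric.isOpen_ball.preimage Λ.continuous
  have hVc : Convex ℝ V := (convex_ball x₀ (d + r)).linear_preimage Λ.toLinearEquiv.toLinearMap
  have hK : IsCompact (Λ ⁻¹' Metric.closedBall x₀ r) :=
    Λ.toHomeomorph.isCompact_preimage.2 (isCompact_closedBall _ _)
  have hK' : IsCompact (Λ ⁻¹' Metric.closedBall x₀ (d / 2 + r)) :=
    Λ.toHomeomorph.isCompact_preimage.2 (isCompact_closedBall _ _)
  have hKV : Λ ⁻¹' Metric.closedBall x₀ (d / 2 + r) ⊆ V :=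
    preimage_mono (Metric.closedBall_subset_ball (by linarith))
  set c : ℝ := ‖(Λ : (ℝ × ℝ) →L[ℝ] EuclideanSpace ℝ (Fin 2))‖ with hc
  have hc0 : 0 ≤ c := norm_nonneg _
  have hθ : 0 < d / 2 / (c + 1) := by positivity
  have hKK : ∀ q ∈ Λ ⁻¹' Metric.closedBall x₀ r,
      Metric.closedBall q (d / 2 / (c + 1)) ⊆ Λ ⁻¹' Metric.closedBall x₀ (d / 2 + r) := by
    intro q hq p hp
    rw [mem_preimage, Metric.mem_closedBall] at hq ⊢
    rw [Metric.mem_closedBall, dist_eq_norm] at hp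
    have h1 : dist (Λ p) (Λ q) ≤ d / 2 := by
      rw [dist_eq_norm, ← map_sub]
      have h2 : ‖Λ (p - q)‖ ≤ c * ‖p - q‖ :=
        (Λ : (ℝ × ℝ) →L[ℝ] EuclideanSpace ℝ (Fin 2)).le_opNorm (p - q)
      have h3 : (c + 1) * ‖p - q‖ ≤ d / 2 := by
        rw [le_div_iff₀ (by positivity)] at hp
        linarith
      linarith [norm_nonneg (p - q)]
    linarith [dist_triangle (Λ p) (Λ q) x₀]
  have hΛa : ∀ q, AnalyticAt ℝ Λ q := fun q =>
    (Λ : (ℝ × ℝ) →L[ℝ] EuclideanSpace ℝ (Fin 2)).analyticAt q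
  have ha' : ∀ k, AnalyticOnNhd ℝ (fun q => a k (Λ q)) V := fun k q hq =>
    (ha k (Λ q) (hVB q hq)).fun_comp (hΛa q)
  have hφ' : AnalyticOnNhd ℝ (fun q => φ (Λ q)) V := fun q hq =>
    (hφ (Λ q) (hVB q hq)).fun_comp (hΛa q)
  have hp : ∃ p ∈ V, dirD (0, 1) (fun q => φ (Λ q)) p ≠ 0 := by
    by_contra! hcon
    have hline : ∀ s : ℝ, Λ (Λ.symm x + s • (0, 1)) = x + s • (y - x) := by
      intro s
      rw [map_add, map_smul, hΛ, ContinuousLinearEquiv.apply_symm_apply]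
    have hmem : ∀ s ∈ Icc (0 : ℝ) 1, Λ.symm x + s • (0, 1) ∈ V := by
      intro s hs
      rw [hVdef, mem_preimage, hline]
      have h1 := (convex_closedBall x₀ r).add_smul_sub_mem hx hy hs
      exact Metric.closedBall_subset_ball (by linarith) h1
    have hder : ∀ s ∈ Icc (0 : ℝ) 1,
        HasDerivWithinAt (fun s : ℝ => φ (Λ (Λ.symm x + s • (0, 1)))) 0 (Icc 0 1) s := by
      intro s hs
      have h1 := line_hasDerivAt (hφ' _ (hmem s hs)).differentiableAt
      rw [hcon _ (hmem s hs)] at h1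
      exact h1.hasDerivWithinAt
    have h2 := (convex_Icc (0 : ℝ) 1).norm_image_sub_le_of_norm_hasDerivWithin_le (C := 0) hder
      (by simp) (left_mem_Icc.2 zero_le_one) (right_mem_Icc.2 zero_le_one)
    simp only [hline] at h2
    simp only [one_smul, zero_smul, add_zero, add_sub_cancel, zero_mul, norm_le_zero_iff,
      sub_eq_zero] at h2
    exact hxy h2.symm
  obtain ⟨p, hpV, hpy⟩ := hp
  have hMain' : ∀ U : Set (ℝ × ℝ), U ⊆ V → IsOpen U → U.Nonempty →
      ∀ f : Fin N → ℝ → ℝ, (∀ k, AnalyticOnNhd ℝ (f k) ((fun q => φ (Λ q)) '' U)) →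
      (∀ x ∈ U, ∑ k, a k (Λ x) * f k (φ (Λ x)) = 0) →
      ∀ k, ∀ y ∈ (fun q => φ (Λ q)) '' U, f k y = 0 := by
    intro U hU hUo hUn f hf hsum
    have himg : (fun q => φ (Λ q)) '' U = φ '' (Λ '' U) := by rw [image_image]
    rw [himg] at hf ⊢
    refine hMain (Λ '' U) ?_ (Λ.toHomeomorph.isOpenMap U hUo) (hUn.image _) f hf ?_
    · rintro _ ⟨q, hq, rfl⟩
      exact hVB q (hU hq)
    · rintro _ ⟨q, hq, rfl⟩
      exact hsum q hq
  obtain ⟨τ, C, hτ, hC, hfinal⟩ := core hV hVc hK hK' hKV hθ hKK ha' hφ' hpV hpy hMain'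
  refine ⟨τ, C0 * C + 1, hτ, by positivity, fun ε hε f hf => ?_⟩
  refine (hcomp _).trans ((mul_le_mul_right (hfinal ε hε f hf) (ENNReal.ofReal C0)).trans ?_)
  rw [← ENNReal.ofReal_mul hC0]
  apply ENNReal.ofReal_le_ofReal
  have : 0 < ε ^ τ := Real.rpow_pos_of_pos hε _
  linarith
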